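/- arXiv:2510.17310 — 8 statements merged into one kernel-verified Lean document; each statement's English description precedes it below -/
import Mathlib

section
/- Let X be a Banach space and let I be a closed two-sided ideal of L(X) that has codimension 1 as a linear subspace of L(X). Then every closed I-subideal J of L(X) is a two-sided ideal of L(X). -/
open Filter Topology

noncomputable section

/-- `J` is a two-sided ideal of the subalgebra `I`. -/
def IsIdealOf {𝕜 A : Type*} [CommSemiring 𝕜] [NonUnitalNonAssocSemiring A] [Module 𝕜 A]
    (J I : NonUnitalSubalgebra 𝕜 A) : Prop :=
  (J : Set A) ⊆ (I : Set A) ∧ ∀ a ∈ I, ∀ x ∈ J, a * x ∈ J ∧ x * a ∈ J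

/-- If a left ideal of a unital algebra has codimension one, then every element is the sum of an
element of the ideal and a scalar multiple of the identity. -/
theorem NonUnitalSubalgebra.exists_sub_smul_one_mem_of_finrank_quotient_eq_one
    {𝕜 A : Type*} [Field 𝕜] [Ring A] [Algebra 𝕜 A] (I : NonUnitalSubalgebra 𝕜 A)
    (hI : ∀ a : A, ∀ x ∈ I, a * x ∈ I)
    (hcodim : Module.finrank 𝕜 (A ⧸ I.toSubmodule) = 1) (a : A) :
    ∃ c : 𝕜, a - c • (1 : A) ∈ I := by
  have h_one : I.toSubmodule.mkQ 1 ≠ 0 := by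
    intro h
    have h_mem : (1 : A) ∈ I := (Submodule.Quotient.mk_eq_zero I.toSubmodule).mp h
    have h_top : I.toSubmodule = ⊤ :=
      eq_top_iff.mpr fun b _ => by simpa using hI b 1 h_mem
    have : Subsingleton (A ⧸ I.toSubmodule) := Submodule.Quotient.subsingleton_iff.mpr h_top
    rw [Module.finrank_zero_of_subsingleton] at hcodim
    exact zero_ne_one hcodim
  obtain ⟨c, hc⟩ := (finrank_eq_one_iff_of_nonzero' _ h_one).mp hcodim (I.toSubmodule.mkQ a)
  refine ⟨c, (Submodule.Quotient.mk_eq_zero I.toSubmodule).mp ?_⟩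
  change I.toSubmodule.mkQ (a - c • (1 : A)) = 0
  rw [map_sub, map_smul, hc, sub_self]

/-- Let `X` be a Banach space and let `I` be a closed two-sided ideal of
`L(X)` of codimension `1` as a linear subspace of `L(X)`.  Then every closed `I`-subideal
`J` of `L(X)` is a two-sided ideal of `L(X)`. -/
theorem closed_subideal_of_codim_one_ideal_is_ideal
    {𝕜 X : Type*} [RCLike 𝕜] [NormedAddCommGroup X] [NormedSpace 𝕜 X] [CompleteSpace X]
    (I : NonUnitalSubalgebra 𝕜 (X →L[𝕜] X))
    (hIclosed : IsClosed (I : Set (X →L[𝕜] X)))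
    (hIideal : ∀ a : X →L[𝕜] X, ∀ x ∈ I, a * x ∈ I ∧ x * a ∈ I)
    (hcodim : Module.finrank 𝕜 ((X →L[𝕜] X) ⧸ I.toSubmodule) = 1)
    (J : NonUnitalSubalgebra 𝕜 (X →L[𝕜] X))
    (hJclosed : IsClosed (J : Set (X →L[𝕜] X)))
    (hJI : IsIdealOf J I) :
    ∀ a : X →L[𝕜] X, ∀ x ∈ J, a * x ∈ J ∧ x * a ∈ J := by
  intro a x hx
  obtain ⟨c, hc⟩ := I.exists_sub_smul_one_mem_of_finrank_quotient_eq_one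
    (fun b y hy => (hIideal b y hy).1) hcodim a
  obtain ⟨h_left, h_right⟩ := hJI.2 _ hc x hx
  have h_smul : c • x ∈ J := J.smul_mem' c hx
  constructor
  · simpa [sub_mul] using J.add_mem h_left h_smul
  · simpa [mul_sub] using J.add_mem h_right h_smul

end
end

section
/- Let X be a Banach space and let q : L(X) → A be a continuous surjective algebra homomorphism onto a Banach algebra A. (i) If J is a non-trivial closed I-subideal of L(X) such that ker(q) ⊆ J, then q(J) is a non-trivial closed q(I)-subideal of A. (ii) If J is a non-trivial closed I-subideal of A, then q⁻¹(J) is a non-trivial closed q⁻¹(I)-subideal of L(X) and ker(q) ⊆ q⁻¹(J). -/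
open Filter Topology

noncomputable section

/-- `J` is a non-trivial closed `I`-subideal of the ambient algebra:  `I` is a closed
two-sided ideal of the ambient algebra, `J` is a closed subalgebra which is a two-sided
ideal of `I`, but `J` is not a two-sided ideal of the ambient algebra. -/
def IsNontrivialClosedSubidealPair {𝕜 A : Type*} [CommSemiring 𝕜] [NonUnitalNonAssocSemiring A]
    [Module 𝕜 A] [TopologicalSpace A] (I J : NonUnitalSubalgebra 𝕜 A) : Prop :=
  IsClosed (I : Set A) ∧ (∀ a : A, ∀ x ∈ I, a * x ∈ I ∧ x * a ∈ I) ∧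
    IsClosed (J : Set A) ∧ IsIdealOf J I ∧
    ¬(∀ a : A, ∀ x ∈ J, a * x ∈ J ∧ x * a ∈ J)

section Correspondence

variable {𝕜 A B : Type*}

section Algebra

variable [CommRing 𝕜] [NonUnitalRing A] [Module 𝕜 A] [NonUnitalRing B] [Module 𝕜 B]

theorem NonUnitalSubalgebra.comap_map_eq_of_ker_le {S : NonUnitalSubalgebra 𝕜 A} {q : A →ₙₐ[𝕜] B}
    (hker : ∀ a : A, q a = 0 → a ∈ S) : (S.map q).comap q = S := by
  ext a
  simp only [NonUnitalSubalgebra.mem_comap, NonUnitalSubalgebra.mem_map]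
  refine ⟨fun ⟨b, hb, hab⟩ => ?_, fun ha => ⟨a, ha, rfl⟩⟩
  have hdiff : a - b ∈ S := hker _ (by rw [map_sub, hab, sub_self])
  simpa using add_mem hdiff hb

theorem NonUnitalSubalgebra.forall_mul_mem_comap_iff {S T : NonUnitalSubalgebra 𝕜 B}
    {q : A →ₙₐ[𝕜] B} (hq : Function.Surjective q) :
    (∀ a ∈ T.comap q, ∀ x ∈ S.comap q, a * x ∈ S.comap q ∧ x * a ∈ S.comap q) ↔
      ∀ b ∈ T, ∀ y ∈ S, b * y ∈ S ∧ y * b ∈ S := by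
  simp only [NonUnitalSubalgebra.mem_comap, map_mul]
  rw [hq.forall]
  exact forall₂_congr fun a _ => (hq.forall (p := fun y => y ∈ S → q a * y ∈ S ∧ y * q a ∈ S)).symm

theorem isIdealOf_comap_iff {I J : NonUnitalSubalgebra 𝕜 B} {q : A →ₙₐ[𝕜] B}
    (hq : Function.Surjective q) : IsIdealOf (J.comap q) (I.comap q) ↔ IsIdealOf J I :=
  and_congr hq.preimage_subset_preimage_iff (NonUnitalSubalgebra.forall_mul_mem_comap_iff hq)

end Algebra

theorem isNontrivialClosedSubidealPair_comap_iff [CommRing 𝕜]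
    [NonUnitalRing A] [Module 𝕜 A] [TopologicalSpace A]
    [NonUnitalRing B] [Module 𝕜 B] [TopologicalSpace B] [IsScalarTower 𝕜 B B]
    [SMulCommClass 𝕜 B B] {I J : NonUnitalSubalgebra 𝕜 B} {q : A →ₙₐ[𝕜] B}
    (hq : IsQuotientMap q) :
    IsNontrivialClosedSubidealPair (I.comap q) (J.comap q) ↔
      IsNontrivialClosedSubidealPair I J := by
  have hideal (S : NonUnitalSubalgebra 𝕜 B) :
      (∀ a : A, ∀ x ∈ S.comap q, a * x ∈ S.comap q ∧ x * a ∈ S.comap q) ↔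
        ∀ b : B, ∀ y ∈ S, b * y ∈ S ∧ y * b ∈ S := by
    simpa [NonUnitalSubalgebra.mem_comap] using
      NonUnitalSubalgebra.forall_mul_mem_comap_iff (S := S) (T := ⊤) hq.surjective
  exact and_congr hq.isClosed_preimage (and_congr (hideal I) (and_congr hq.isClosed_preimage
    (and_congr (isIdealOf_comap_iff hq.surjective) (not_congr (hideal J)))))

end Correspondence

/-- Let `X` be a Banach space and let `q : L(X) → A` be a continuous
surjective algebra homomorphism onto a Banach algebra `A`.
(i) If `J` is a non-trivial closed `I`-subideal of `L(X)` with `ker q ⊆ J`, then `q(J)` is a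
non-trivial closed `q(I)`-subideal of `A`.
(ii) If `J` is a non-trivial closed `I`-subideal of `A`, then `q⁻¹(J)` is a non-trivial closed
`q⁻¹(I)`-subideal of `L(X)` and `ker q ⊆ q⁻¹(J)`. -/
theorem subideals_correspondence_along_quotient_homomorphism
    {𝕜 X A : Type*} [RCLike 𝕜] [NormedAddCommGroup X] [NormedSpace 𝕜 X] [CompleteSpace X]
    [NonUnitalNormedRing A] [NormedSpace 𝕜 A] [IsScalarTower 𝕜 A A] [SMulCommClass 𝕜 A A]
    [CompleteSpace A]
    (q : (X →L[𝕜] X) →ₙₐ[𝕜] A) (hqcont : Continuous q) (hqsurj : Function.Surjective q) :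
    (∀ I J : NonUnitalSubalgebra 𝕜 (X →L[𝕜] X),
      IsNontrivialClosedSubidealPair I J → (∀ T : X →L[𝕜] X, q T = 0 → T ∈ J) →
        IsNontrivialClosedSubidealPair (I.map q) (J.map q)) ∧
    (∀ I J : NonUnitalSubalgebra 𝕜 A,
      IsNontrivialClosedSubidealPair I J →
        IsNontrivialClosedSubidealPair (I.comap q) (J.comap q) ∧
          ∀ T : X →L[𝕜] X, q T = 0 → T ∈ J.comap q) := by
  let Q : (X →L[𝕜] X) →L[𝕜] A := ⟨(q : (X →L[𝕜] X) →ₗ[𝕜] A), hqcont⟩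
  have hquot : IsQuotientMap q := Q.isQuotientMap hqsurj
  refine ⟨fun I J h hker => ?_, fun I J h =>
    ⟨(isNontrivialClosedSubidealPair_comap_iff hquot).2 h, fun T hT => ?_⟩⟩
  · rw [← isNontrivialClosedSubidealPair_comap_iff hquot,
      NonUnitalSubalgebra.comap_map_eq_of_ker_le fun T hT => h.2.2.2.1.1 (hker T hT),
      NonUnitalSubalgebra.comap_map_eq_of_ker_le hker]
    exact h
  · rw [NonUnitalSubalgebra.mem_comap, hT]
    exact zero_mem J

end
end

section
/- Let K be a compact metric space and let C(K) be the sup-normed Banach algebra of continuous scalar-valued (real or complex) functions on K. Then C(K) has no non-trivial closed subideals: whenever I is a closed two-sided ideal of C(K) and J ⊆ I is a closed subalgebra that is a two-sided ideal of I, then J is a two-sided ideal of C(K). -/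
open Filter Topology

noncomputable section

/-- In `C(K, 𝕜)`, every product `a * x` is a uniform limit of products `a * b * x * x` with
`b ∈ C(K, 𝕜)`. -/
lemma ContinuousMap.exists_norm_mul_mul_mul_sub_lt {𝕜 K : Type*} [RCLike 𝕜] [TopologicalSpace K]
    [CompactSpace K] (a x : C(K, 𝕜)) {ε : ℝ} (hε : 0 < ε) :
    ∃ b : C(K, 𝕜), ‖a * b * x * x - a * x‖ < ε := by
  obtain ⟨δ, hδ, hδε⟩ : ∃ δ : ℝ, 0 < δ ∧ ‖a‖ * δ < ε := by
    refine ⟨ε / (‖a‖ + 1), by positivity, ?_⟩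
    rw [mul_div_assoc', div_lt_iff₀ (by positivity)]
    nlinarith [norm_nonneg a]
  have hpos (k : K) : 0 < ‖x k‖ ^ 2 + δ ^ 2 := by positivity
  let b : C(K, 𝕜) :=
    ⟨fun k ↦ star (x k) * (((‖x k‖ ^ 2 + δ ^ 2)⁻¹ : ℝ) : 𝕜), by
      refine (continuous_star.comp x.continuous).mul (RCLike.continuous_ofReal.comp ?_)
      exact ((x.continuous.norm.pow 2).add continuous_const).inv₀ fun k ↦ (hpos k).ne'⟩
  refine ⟨b, lt_of_le_of_lt ((ContinuousMap.norm_le _ (by positivity)).2 fun k ↦ ?_) hδε⟩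
  have hfactor : (a * b * x * x - a * x) k =
      a k * (((-(δ ^ 2 / (‖x k‖ ^ 2 + δ ^ 2)) : ℝ) : 𝕜) * x k) := by
    have hconj : star (x k) * x k = ((‖x k‖ ^ 2 : ℝ) : 𝕜) := by
      simpa using RCLike.conj_mul (x k)
    have hscalar : ‖x k‖ ^ 2 * (‖x k‖ ^ 2 + δ ^ 2)⁻¹ - 1 =
        -(δ ^ 2 / (‖x k‖ ^ 2 + δ ^ 2)) := by
      field_simp [(hpos k).ne']
      ring
    rw [← hscalar, RCLike.ofReal_sub, RCLike.ofReal_mul, ← hconj, RCLike.ofReal_one]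
    simp only [ContinuousMap.sub_apply, ContinuousMap.mul_apply, b, ContinuousMap.coe_mk]
    ring
  rw [hfactor, norm_mul, norm_mul, RCLike.norm_ofReal, abs_neg, abs_of_pos (by positivity)]
  refine mul_le_mul (a.norm_coe_le_norm k) ?_ (by positivity) (norm_nonneg a)
  rw [div_mul_eq_mul_div, div_le_iff₀ (hpos k)]
  nlinarith [mul_nonneg hδ.le (sq_nonneg (‖x k‖ - δ)),
    mul_nonneg hδ.le (mul_nonneg hδ.le (norm_nonneg (x k)))]

/-- Let `K` be a compact metric space and let `C(K)` be the sup-normed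
Banach algebra of continuous scalar-valued (real or complex) functions on `K`.  Then `C(K)`
has no non-trivial closed subideals: whenever `I` is a closed two-sided ideal of `C(K)` and
`J ⊆ I` is a closed subalgebra that is a two-sided ideal of `I`, then `J` is a two-sided
ideal of `C(K)`. -/
theorem continuousMap_no_nontrivial_closed_subideals
    {𝕜 K : Type*} [RCLike 𝕜] [MetricSpace K] [CompactSpace K]
    (I : NonUnitalSubalgebra 𝕜 C(K, 𝕜)) (hIclosed : IsClosed (I : Set C(K, 𝕜)))
    (hIideal : ∀ a : C(K, 𝕜), ∀ x ∈ I, a * x ∈ I ∧ x * a ∈ I)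
    (J : NonUnitalSubalgebra 𝕜 C(K, 𝕜)) (hJclosed : IsClosed (J : Set C(K, 𝕜)))
    (hJI : IsIdealOf J I) :
    ∀ a : C(K, 𝕜), ∀ x ∈ J, a * x ∈ J ∧ x * a ∈ J := by
  intro a x hx
  rw [mul_comm x a, and_self, ← SetLike.mem_coe, ← hJclosed.closure_eq, Metric.mem_closure_iff]
  intro ε hε
  obtain ⟨b, hb⟩ := ContinuousMap.exists_norm_mul_mul_mul_sub_lt a x hε
  exact ⟨a * b * x * x, (hJI.2 _ (hIideal (a * b) x (hJI.1 hx)).1 x hx).1,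
    by rwa [dist_comm, dist_eq_norm]⟩

end
end

section
/- Let X be a Banach space and n ∈ ℕ. If I is a non-zero n-subideal of L(X), then F(X) ⊆ I, where F(X) denotes the bounded finite-rank operators on X. In particular, if I is a non-zero closed n-subideal of L(X), then A(X) ⊆ I, where A(X) is the operator-norm closure of F(X). -/
open Filter Topology

noncomputable section

/-- The set `S` is an `n`-subideal of the algebra `A`. -/
def IsNSubideal (𝕜 : Type*) {A : Type*} [CommSemiring 𝕜] [NonUnitalNonAssocSemiring A]
    [Module 𝕜 A] (n : ℕ) (S : Set A) : Prop :=
  ∃ C : ℕ → NonUnitalSubalgebra 𝕜 A, (C 0 : Set A) = Set.univ ∧ (C n : Set A) = S ∧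
    ∀ k < n, IsIdealOf (C (k + 1)) (C k)

/-- The set `S` is a closed `n`-subideal of the algebra `A`. -/
def IsClosedNSubideal (𝕜 : Type*) {A : Type*} [CommSemiring 𝕜] [NonUnitalNonAssocSemiring A]
    [Module 𝕜 A] [TopologicalSpace A] (n : ℕ) (S : Set A) : Prop :=
  ∃ C : ℕ → NonUnitalSubalgebra 𝕜 A, (C 0 : Set A) = Set.univ ∧ (C n : Set A) = S ∧
    (∀ k ≤ n, IsClosed (C k : Set A)) ∧ ∀ k < n, IsIdealOf (C (k + 1)) (C k)

/-- The bounded finite-rank operators from `X` to `Y`. -/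
def finRankOps (𝕜 X Y : Type*) [NontriviallyNormedField 𝕜] [NormedAddCommGroup X]
    [NormedSpace 𝕜 X] [NormedAddCommGroup Y] [NormedSpace 𝕜 Y] : Set (X →L[𝕜] Y) :=
  {T | FiniteDimensional 𝕜 (LinearMap.range (T : X →ₗ[𝕜] Y))}

/-- The approximable operators from `X` to `Y`. -/
def approxOps (𝕜 X Y : Type*) [NontriviallyNormedField 𝕜] [NormedAddCommGroup X]
    [NormedSpace 𝕜 X] [NormedAddCommGroup Y] [NormedSpace 𝕜 Y] : Set (X →L[𝕜] Y) :=
  closure (finRankOps 𝕜 X Y)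

/-- A subspace of operators containing every rank-one operator contains every finite-rank one. -/
theorem finRankOps_subset_of_smulRight_mem {𝕜 X Y : Type*} [NontriviallyNormedField 𝕜]
    [CompleteSpace 𝕜] [NormedAddCommGroup X] [NormedSpace 𝕜 X] [NormedAddCommGroup Y]
    [NormedSpace 𝕜 Y] {S : Submodule 𝕜 (X →L[𝕜] Y)}
    (h : ∀ (g : X →L[𝕜] 𝕜) (y : Y), g.smulRight y ∈ S) :
    finRankOps 𝕜 X Y ⊆ S := by
  intro T hT
  have : FiniteDimensional 𝕜 (LinearMap.range (T : X →ₗ[𝕜] Y)) := hT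
  let b := Module.finBasis 𝕜 (LinearMap.range (T : X →ₗ[𝕜] Y))
  let R : X →L[𝕜] LinearMap.range (T : X →ₗ[𝕜] Y) :=
    T.codRestrict _ fun x => LinearMap.mem_range_self (T : X →ₗ[𝕜] Y) x
  have hsum : T = ∑ i, ((LinearMap.toContinuousLinearMap (b.coord i)).comp R).smulRight
      (b i : Y) := by
    ext x
    have hx := congrArg Subtype.val (b.sum_repr (R x))
    simp only [Submodule.coe_sum, Submodule.coe_smul] at hx
    have hR : (R x : Y) = T x := rfl
    simpa [hR, _root_.sum_apply] using hx.symm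
  rw [hsum]
  exact S.sum_mem fun i _ => h _ _

/-- A non-zero ideal of an algebra containing the finite-rank operators contains them too. -/
theorem IsIdealOf.finRankOps_subset {𝕜 X : Type*} [RCLike 𝕜] [NormedAddCommGroup X]
    [NormedSpace 𝕜 X] {J I : NonUnitalSubalgebra 𝕜 (X →L[𝕜] X)} (hJ : IsIdealOf J I)
    (hI : finRankOps 𝕜 X X ⊆ I) {T : X →L[𝕜] X} (hT : T ∈ J) (hT0 : T ≠ 0) :
    finRankOps 𝕜 X X ⊆ J := by
  obtain ⟨x, hx⟩ : ∃ x, T x ≠ 0 := by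
    by_contra! h
    exact hT0 (ContinuousLinearMap.ext h)
  obtain ⟨f, hf⟩ := SeparatingDual.exists_eq_one (R := 𝕜) hx
  have hmem (g : X →L[𝕜] 𝕜) (y : X) : g.smulRight y ∈ I := by
    refine hI (Submodule.finiteDimensional_of_le (S₂ := 𝕜 ∙ y) ?_)
    rintro _ ⟨z, rfl⟩
    exact Submodule.mem_span_singleton.2 ⟨g z, rfl⟩
  refine finRankOps_subset_of_smulRight_mem (S := J.toSubmodule) fun g y => ?_
  have hg : g.smulRight y = f.smulRight y * (T * g.smulRight x) := by
    ext z
    simp [hf]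
  rw [hg]
  exact (hJ.2 _ (hmem f y) _ (hJ.2 _ (hmem g x) _ hT).2).1

/-- Every non-zero `n`-subideal of `L(X)` contains the finite-rank operators. -/
theorem IsNSubideal.finRankOps_subset {𝕜 X : Type*} [RCLike 𝕜] [NormedAddCommGroup X]
    [NormedSpace 𝕜 X] {n : ℕ} {S : Set (X →L[𝕜] X)} (hS : IsNSubideal 𝕜 n S)
    {T : X →L[𝕜] X} (hT : T ∈ S) (hT0 : T ≠ 0) : finRankOps 𝕜 X X ⊆ S := by
  obtain ⟨C, h0, rfl, hC⟩ := hS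
  have hmem (k : ℕ) (hk : k ≤ n) : T ∈ C k :=
    Nat.decreasingInduction' (P := fun k => T ∈ C k) (fun k hk _ h => (hC k hk).1 h) hk hT
  have key (k : ℕ) (hk : k ≤ n) : finRankOps 𝕜 X X ⊆ (C k : Set (X →L[𝕜] X)) := by
    induction k with
    | zero => simp [h0]
    | succ k ih => exact (hC k hk).finRankOps_subset (ih (by omega)) (hmem _ hk) hT0
  exact key n le_rfl

/-- Let `X` be a Banach space and `n ∈ ℕ`.  Every non-zero `n`-subideal
of `L(X)` contains the bounded finite-rank operators `F(X)`; in particular every non-zero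
closed `n`-subideal of `L(X)` contains the approximable operators `A(X)`. -/
theorem nsubideal_contains_finRank
    {𝕜 X : Type*} [RCLike 𝕜] [NormedAddCommGroup X] [NormedSpace 𝕜 X] [CompleteSpace X]
    (n : ℕ) (hn : 1 ≤ n) :
    (∀ S : Set (X →L[𝕜] X), IsNSubideal 𝕜 n S → (∃ T ∈ S, T ≠ 0) →
      finRankOps 𝕜 X X ⊆ S) ∧
    (∀ S : Set (X →L[𝕜] X), IsClosedNSubideal 𝕜 n S → (∃ T ∈ S, T ≠ 0) →
      approxOps 𝕜 X X ⊆ S) := by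
  refine ⟨fun S hS ⟨T, hT, hT0⟩ => hS.finRankOps_subset hT hT0, ?_⟩
  rintro S ⟨C, h0, rfl, hcl, hC⟩ ⟨T, hT, hT0⟩
  have hS : IsNSubideal 𝕜 n (C n : Set (X →L[𝕜] X)) := ⟨C, h0, rfl, hC⟩
  exact closure_minimal (hS.finRankOps_subset hT hT0) (hcl n le_rfl)

end
end

section
/- Let A be a Banach algebra, let n ≥ 2, and let I be a closed n-subideal of A with an associated chain of closed subalgebras I = J_n ⊆ J_{n−1} ⊆ ⋯ ⊆ J_1 ⊆ J_0 = A in which J_k is a two-sided ideal of J_{k−1} for each k = 1,…,n. If J_k or J_{k−1} has an approximate identity for some k ∈ {2,…,n}, then I is a closed (n−k+1)-subideal of A. In particular, if I or J_{n−1} has an approximate identity, then I is a closed two-sided ideal of A. -/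
open Filter Topology

noncomputable section

/-- The set `S` has an approximate identity: a net `(e_α)` in `S` such that
`e_α x → x` and `x e_α → x` for every `x ∈ S`. -/
def HasApproximateIdentity {A : Type u} [NonUnitalNonAssocSemiring A] [TopologicalSpace A]
    (S : Set A) : Prop :=
  ∃ (ι : Type u) (l : Filter ι), l.NeBot ∧ ∃ e : ι → A, (∀ i, e i ∈ S) ∧
    ∀ x ∈ S, Tendsto (fun i => e i * x) l (𝓝 x) ∧ Tendsto (fun i => x * e i) l (𝓝 x)

/-- If `J` is a closed ideal of `K`, `K` is an ideal of `B`, and some set `S` with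
`J ⊆ S ⊆ K` has an approximate identity, then `J` is an ideal of `B`. -/
theorem IsIdealOf.trans_of_hasApproximateIdentity {𝕜 : Type*} {A : Type u} [CommSemiring 𝕜]
    [NonUnitalNormedRing A] [Module 𝕜 A] {J K B : NonUnitalSubalgebra 𝕜 A} {S : Set A}
    (hJK : IsIdealOf J K) (hKB : IsIdealOf K B) (hJ : IsClosed (J : Set A))
    (hJS : (J : Set A) ⊆ S) (hSK : S ⊆ (K : Set A)) (hS : HasApproximateIdentity S) :
    IsIdealOf J B := by
  obtain ⟨ι, l, hl, e, heS, he⟩ := hS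
  refine ⟨hJK.1.trans hKB.1, fun a ha x hx => ⟨?_, ?_⟩⟩
  · refine hJ.mem_of_tendsto ((he x (hJS hx)).1.const_mul a) (Eventually.of_forall fun i => ?_)
    rw [← mul_assoc]
    exact (hJK.2 _ (hKB.2 a ha _ (hSK (heS i))).1 x hx).1
  · refine hJ.mem_of_tendsto ((he x (hJS hx)).2.mul_const a) (Eventually.of_forall fun i => ?_)
    rw [mul_assoc]
    exact (hJK.2 _ (hKB.2 a ha _ (hSK (heS i))).2 x hx).2

/-- In a chain of successive ideals, a closed member with an approximate identity is an ideal of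
every earlier member. -/
theorem isIdealOf_of_chain_of_hasApproximateIdentity {𝕜 : Type*} {A : Type u} [CommSemiring 𝕜]
    [NonUnitalNormedRing A] [Module 𝕜 A] {C : ℕ → NonUnitalSubalgebra 𝕜 A} {m : ℕ}
    (hC : ∀ k < m, IsIdealOf (C (k + 1)) (C k)) (hclosed : IsClosed (C m : Set A))
    (hAI : HasApproximateIdentity (C m : Set A)) {j : ℕ} (hj : j < m) :
    IsIdealOf (C m) (C j) := by
  obtain ⟨d, rfl⟩ := Nat.exists_eq_add_of_lt hj
  induction d generalizing j with
  | zero => exact hC j hj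
  | succ d ih =>
    have h : j + (d + 1) + 1 = j + 1 + d + 1 := by omega
    rw [h] at hC hclosed hAI ⊢
    have hstep := ih hC hclosed hAI (by omega)
    exact hstep.trans_of_hasApproximateIdentity (hC j (by omega)) hclosed subset_rfl hstep.1 hAI

/-- Let `I = J_n ⊆ J_{n-1} ⊆ ⋯ ⊆ J_1 ⊆ J_0 = A` be a chain of closed
subalgebras of a Banach algebra `A` with `J_k` a two-sided ideal of `J_{k-1}` for each
`k = 1, …, n` (so `I` is a closed `n`-subideal of `A`), where `n ≥ 2`.  If `J_k` or
`J_{k-1}` has an approximate identity for some `k ∈ {2, …, n}`, then `I` is a closed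
`(n - k + 1)`-subideal of `A`.  (In particular, taking `k = n`: if `I` or `J_{n-1}` has an
approximate identity, then `I` is a closed two-sided ideal of `A`.) -/
theorem closed_nsubideal_of_approximate_identity
    {𝕜 : Type*} {A : Type u} [RCLike 𝕜] [NonUnitalNormedRing A] [NormedSpace 𝕜 A]
    [IsScalarTower 𝕜 A A] [SMulCommClass 𝕜 A A] [CompleteSpace A]
    (n : ℕ) (hn : 2 ≤ n)
    (C : ℕ → NonUnitalSubalgebra 𝕜 A) (hC0 : C 0 = ⊤)
    (hCclosed : ∀ k ≤ n, IsClosed (C k : Set A))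
    (hCideal : ∀ k < n, IsIdealOf (C (k + 1)) (C k))
    (k : ℕ) (hk2 : 2 ≤ k) (hkn : k ≤ n)
    (hAI : HasApproximateIdentity (C k : Set A) ∨
      HasApproximateIdentity (C (k - 1) : Set A)) :
    IsClosedNSubideal 𝕜 (n - k + 1) (C n : Set A) := by
  obtain ⟨m, rfl⟩ : ∃ m, k = m + 1 := ⟨k - 1, by omega⟩
  have hideal : IsIdealOf (C (m + 1)) (C 0) := by
    rcases hAI with hAI | hAI
    · exact isIdealOf_of_chain_of_hasApproximateIdentity (fun j hj => hCideal j (by omega))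
        (hCclosed _ hkn) hAI (by omega)
    · rw [Nat.add_sub_cancel] at hAI
      have hm : IsIdealOf (C m) (C 0) :=
        isIdealOf_of_chain_of_hasApproximateIdentity (fun j hj => hCideal j (by omega))
          (hCclosed _ (by omega)) hAI (by omega)
      have hstep := hCideal m (by omega)
      exact hstep.trans_of_hasApproximateIdentity hm (hCclosed _ hkn) hstep.1 subset_rfl hAI
  refine ⟨fun j => if j = 0 then C 0 else C (m + j), by simp [hC0], ?_, fun j hj => ?_,
    fun j hj => ?_⟩
  · have h : m + (n - (m + 1) + 1) = n := by omega
    simp [h]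
  · dsimp only
    split_ifs
    · exact hCclosed 0 (by omega)
    · exact hCclosed _ (by omega)
  · rcases j with _ | j
    · simpa using hideal
    · simpa [add_assoc] using hCideal (m + (j + 1)) (by omega)

end
end

section
/- Let n ∈ ℕ and let X be a Banach space for which there exist a closed two-sided ideal I of L(X) and an operator S ∈ I such that S^n does not belong to the operator-norm closure of I^{n+1}, where I^{n+1} denotes the linear span of all products of n+1 elements of I. Then, for Z = X ⊕ X, there exists a closed subalgebra M of L(Z) that is a closed (n+1)-subideal of L(Z) but not a closed n-subideal of L(Z). -/
open Filter Topology

noncomputable section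

/-- Products of `n + 1` elements of the set `S`. -/
def prodsOf {A : Type*} [Mul A] (S : Set A) : ℕ → Set A
  | 0 => S
  | n + 1 => {x | ∃ y ∈ prodsOf S n, ∃ s ∈ S, x = y * s}

section ClosedPowers

variable {𝕜 A : Type*} [NontriviallyNormedField 𝕜] [NormedRing A] [NormedAlgebra 𝕜 A]

/-- The closed linear span of the products of `m + 1` elements of `I`. -/
def closedPower (I : NonUnitalSubalgebra 𝕜 A) (m : ℕ) : Submodule 𝕜 A :=
  (Submodule.span 𝕜 (prodsOf (I : Set A) m)).topologicalClosure

variable {I : NonUnitalSubalgebra 𝕜 A}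

theorem isClosed_closedPower (m : ℕ) : IsClosed (closedPower I m : Set A) :=
  Submodule.isClosed_topologicalClosure _

theorem mul_mem_prodsOf {a : A} (ha : a ∈ I) :
    ∀ (m : ℕ) {x : A}, x ∈ prodsOf (I : Set A) m → a * x ∈ prodsOf (I : Set A) (m + 1)
  | 0, x, hx => ⟨a, ha, x, hx, rfl⟩
  | m + 1, _, ⟨y, hy, s, hs, h⟩ => ⟨a * y, mul_mem_prodsOf ha m hy, s, hs, by rw [h, mul_assoc]⟩

theorem prodsOf_succ_subset :
    ∀ m : ℕ, prodsOf (I : Set A) (m + 1) ⊆ prodsOf (I : Set A) m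
  | 0, _, ⟨_, hy, _, hs, h⟩ => h ▸ mul_mem hy hs
  | m + 1, _, ⟨y, hy, s, hs, h⟩ => ⟨y, prodsOf_succ_subset m hy, s, hs, h⟩

theorem closedPower_succ_le (m : ℕ) : closedPower I (m + 1) ≤ closedPower I m :=
  Submodule.topologicalClosure_mono (Submodule.span_mono (prodsOf_succ_subset m))

theorem closedPower_zero (hI : IsClosed (I : Set A)) : closedPower I 0 = I.toSubmodule := by
  have h : Submodule.span 𝕜 (prodsOf (I : Set A) 0) = I.toSubmodule :=
    Submodule.span_eq I.toSubmodule
  rw [closedPower, h]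
  exact IsClosed.submodule_topologicalClosure_eq hI

theorem map_mem_closedPower (f : A →L[𝕜] A) {m k : ℕ}
    (hf : ∀ x ∈ prodsOf (I : Set A) m, f x ∈ prodsOf (I : Set A) k) {x : A}
    (hx : x ∈ closedPower I m) : f x ∈ closedPower I k := by
  refine map_mem_closure f.continuous hx fun y hy => ?_
  have h : Submodule.span 𝕜 (prodsOf (I : Set A) m) ≤
      (Submodule.span 𝕜 (prodsOf (I : Set A) k)).comap (f : A →ₗ[𝕜] A) :=
    Submodule.span_le.2 fun z hz => Submodule.subset_span (hf z hz)
  exact h hy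

theorem mul_mem_closedPower_succ {a x : A} {m : ℕ} (ha : a ∈ I) (hx : x ∈ closedPower I m) :
    a * x ∈ closedPower I (m + 1) :=
  map_mem_closedPower (ContinuousLinearMap.mul 𝕜 A a) (fun _ hy => mul_mem_prodsOf ha m hy) hx

theorem closedPower_mul_mem_succ {a x : A} {m : ℕ} (ha : a ∈ I) (hx : x ∈ closedPower I m) :
    x * a ∈ closedPower I (m + 1) :=
  map_mem_closedPower (k := m + 1) ((ContinuousLinearMap.mul 𝕜 A).flip a)
    (fun y hy => ⟨y, hy, a, ha, rfl⟩) hx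

theorem closedPower_le (hI : IsClosed (I : Set A)) : ∀ m : ℕ, closedPower I m ≤ I.toSubmodule
  | 0 => (closedPower_zero hI).le
  | m + 1 => (closedPower_succ_le m).trans (closedPower_le hI m)

/-- The entries allowed at each position of a `2 × 2` matrix: `I` in the upper left corner, and
`closedPower I m` elsewhere. -/
def cornerEntries (I : NonUnitalSubalgebra 𝕜 A) (m : ℕ) (i j : Fin 2) : Submodule 𝕜 A :=
  if i = 0 ∧ j = 0 then I.toSubmodule else closedPower I m

theorem cornerEntries_le (hI : IsClosed (I : Set A)) (m : ℕ) (i j : Fin 2) :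
    cornerEntries I m i j ≤ I.toSubmodule := by
  unfold cornerEntries
  split_ifs
  exacts [le_rfl, closedPower_le hI m]

theorem cornerEntries_zero (hI : IsClosed (I : Set A)) (i j : Fin 2) :
    cornerEntries I 0 i j = I.toSubmodule := by
  unfold cornerEntries
  split_ifs
  exacts [rfl, closedPower_zero hI]

theorem closedPower_le_cornerEntries (hI : IsClosed (I : Set A)) (m : ℕ) (i j : Fin 2) :
    closedPower I m ≤ cornerEntries I m i j := by
  unfold cornerEntries
  split_ifs
  exacts [closedPower_le hI m, le_rfl]

theorem cornerEntries_succ_le (m : ℕ) (i j : Fin 2) :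
    cornerEntries I (m + 1) i j ≤ cornerEntries I m i j := by
  unfold cornerEntries
  split_ifs
  exacts [le_rfl, closedPower_succ_le m]

theorem isClosed_cornerEntries (hI : IsClosed (I : Set A)) (m : ℕ) (i j : Fin 2) :
    IsClosed (cornerEntries I m i j : Set A) := by
  unfold cornerEntries
  split_ifs
  exacts [hI, isClosed_closedPower m]

theorem cornerEntries_mul_mem (hI : IsClosed (I : Set A)) {m : ℕ} {i l j : Fin 2} {a b : A}
    (ha : a ∈ cornerEntries I m i l) (hb : b ∈ cornerEntries I (m + 1) l j) :
    a * b ∈ cornerEntries I (m + 1) i j := by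
  have ha' : a ∈ I := cornerEntries_le hI m i l ha
  have hb' : b ∈ I := cornerEntries_le hI (m + 1) l j hb
  by_cases hlj : l = 0 ∧ j = 0
  · by_cases hil : i = 0 ∧ l = 0
    · rw [cornerEntries, if_pos ⟨hil.1, hlj.2⟩]
      exact I.mul_mem ha' hb'
    · rw [cornerEntries, if_neg hil] at ha
      exact closedPower_le_cornerEntries hI _ _ _ (closedPower_mul_mem_succ hb' ha)
  · rw [cornerEntries, if_neg hlj] at hb
    exact closedPower_le_cornerEntries hI _ _ _
      (closedPower_succ_le _ (mul_mem_closedPower_succ ha' hb))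

theorem mul_mem_cornerEntries (hI : IsClosed (I : Set A)) {m : ℕ} {i l j : Fin 2} {a b : A}
    (ha : a ∈ cornerEntries I (m + 1) i l) (hb : b ∈ cornerEntries I m l j) :
    a * b ∈ cornerEntries I (m + 1) i j := by
  have ha' : a ∈ I := cornerEntries_le hI (m + 1) i l ha
  have hb' : b ∈ I := cornerEntries_le hI m l j hb
  by_cases hil : i = 0 ∧ l = 0
  · by_cases hlj : l = 0 ∧ j = 0
    · rw [cornerEntries, if_pos ⟨hil.1, hlj.2⟩]
      exact I.mul_mem ha' hb'
    · rw [cornerEntries, if_neg hlj] at hb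
      exact closedPower_le_cornerEntries hI _ _ _ (mul_mem_closedPower_succ ha' hb)
  · rw [cornerEntries, if_neg hil] at ha
    exact closedPower_le_cornerEntries hI _ _ _
      (closedPower_succ_le _ (closedPower_mul_mem_succ hb' ha))

end ClosedPowers

section BlockOperators

variable {𝕜 X : Type*} [NontriviallyNormedField 𝕜] [NormedAddCommGroup X] [NormedSpace 𝕜 X]

/-- The coordinate projections of `X × X`. -/
def coordProj (i : Fin 2) : (X × X) →L[𝕜] X :=
  if i = 0 then ContinuousLinearMap.fst 𝕜 X X else ContinuousLinearMap.snd 𝕜 X X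

/-- The coordinate inclusions of `X × X`. -/
def coordIncl (i : Fin 2) : X →L[𝕜] (X × X) :=
  if i = 0 then ContinuousLinearMap.inl 𝕜 X X else ContinuousLinearMap.inr 𝕜 X X

theorem coordIncl_comp_coordProj_add :
    (coordIncl (𝕜 := 𝕜) (X := X) 0).comp (coordProj 0) + (coordIncl 1).comp (coordProj 1) =
      ContinuousLinearMap.id 𝕜 (X × X) := by
  ext x <;> simp [coordIncl, coordProj]

theorem coordProj_comp_coordIncl_self (i : Fin 2) :
    (coordProj (𝕜 := 𝕜) (X := X) i).comp (coordIncl i) = ContinuousLinearMap.id 𝕜 X := by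
  ext x
  fin_cases i <;> simp [coordIncl, coordProj]

theorem coordProj_comp_coordIncl_of_ne {i j : Fin 2} (h : i ≠ j) :
    (coordProj (𝕜 := 𝕜) (X := X) i).comp (coordIncl j) = 0 := by
  ext x
  fin_cases i <;> fin_cases j <;> simp_all [coordIncl, coordProj]

/-- The `(i, j)` entry of the `2 × 2` operator matrix of an operator on `X × X`. -/
def blockEntry (i j : Fin 2) : ((X × X) →L[𝕜] (X × X)) →L[𝕜] (X →L[𝕜] X) :=
  (ContinuousLinearMap.compL 𝕜 X (X × X) X (coordProj i)).comp
    ((ContinuousLinearMap.compL 𝕜 X (X × X) (X × X)).flip (coordIncl j))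

theorem blockEntry_apply (i j : Fin 2) (f : (X × X) →L[𝕜] (X × X)) :
    blockEntry i j f = (coordProj i).comp (f.comp (coordIncl j)) := rfl

theorem blockEntry_mul (i j : Fin 2) (f g : (X × X) →L[𝕜] (X × X)) :
    blockEntry i j (f * g) =
      blockEntry i 0 f * blockEntry 0 j g + blockEntry i 1 f * blockEntry 1 j g := by
  ext x
  have h := DFunLike.congr_fun (coordIncl_comp_coordProj_add (𝕜 := 𝕜) (X := X))
    (g (coordIncl (𝕜 := 𝕜) j x))
  simp only [add_apply, ContinuousLinearMap.comp_apply,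
    ContinuousLinearMap.id_apply] at h
  let p (k : Fin 2) : (X × X) →L[𝕜] X := coordProj k
  let e (k : Fin 2) : X →L[𝕜] (X × X) := coordIncl k
  change p i (f (g (e j x))) = p i (f (e 0 (p 0 (g (e j x))))) + p i (f (e 1 (p 1 (g (e j x)))))
  rw [← map_add, ← map_add, h]

/-- The operator on `X × X` whose matrix has `T` in position `(i, j)` and zeros elsewhere. -/
def singleBlock (i j : Fin 2) (T : X →L[𝕜] X) : (X × X) →L[𝕜] (X × X) :=
  (coordIncl i).comp (T.comp (coordProj j))

theorem singleBlock_mul_singleBlock (i l j : Fin 2) (T U : X →L[𝕜] X) :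
    singleBlock i l T * singleBlock l j U = singleBlock i j (T * U) := by
  refine ContinuousLinearMap.ext fun x => ?_
  have h (y : X) := DFunLike.congr_fun (coordProj_comp_coordIncl_self (𝕜 := 𝕜) l) y
  simp_all [singleBlock]

theorem blockEntry_singleBlock (i j : Fin 2) (T : X →L[𝕜] X) :
    blockEntry i j (singleBlock i j T) = T := by
  ext x
  have hi (y : X) := DFunLike.congr_fun (coordProj_comp_coordIncl_self (𝕜 := 𝕜) i) y
  have hj (y : X) := DFunLike.congr_fun (coordProj_comp_coordIncl_self (𝕜 := 𝕜) j) y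
  simp_all [singleBlock, blockEntry_apply]

theorem blockEntry_singleBlock_of_ne {i j k l : Fin 2} (h : ¬(k = i ∧ l = j)) (T : X →L[𝕜] X) :
    blockEntry k l (singleBlock i j T) = 0 := by
  ext x
  have h' {a b : Fin 2} (hab : a ≠ b) (y : X) :=
    DFunLike.congr_fun (coordProj_comp_coordIncl_of_ne (𝕜 := 𝕜) (X := X) hab) y
  simp only [ContinuousLinearMap.comp_apply, zero_apply] at h'
  by_cases hk : k = i
  · simp [singleBlock, blockEntry_apply, h' fun hl : j = l => h ⟨hk, hl.symm⟩]
  · simp [singleBlock, blockEntry_apply, h' hk]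

/-- The operators on `X × X` whose matrix has entries in `cornerEntries I m`. -/
def cornerSubalgebra (I : NonUnitalSubalgebra 𝕜 (X →L[𝕜] X))
    (hI : IsClosed (I : Set (X →L[𝕜] X))) (m : ℕ) :
    NonUnitalSubalgebra 𝕜 ((X × X) →L[𝕜] (X × X)) where
  carrier := {f | ∀ i j, blockEntry i j f ∈ cornerEntries I m i j}
  add_mem' hf hg i j := by
    rw [map_add]
    exact add_mem (hf i j) (hg i j)
  zero_mem' i j := by
    rw [map_zero]
    exact zero_mem _
  smul_mem' c f hf i j := by
    rw [map_smul]
    exact Submodule.smul_mem _ c (hf i j)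
  mul_mem' {f g} hf hg i j := by
    have h (l : Fin 2) : blockEntry i l f * blockEntry l j g ∈ cornerEntries I m i j := by
      cases m with
      | zero =>
        rw [cornerEntries_zero hI]
        exact mul_mem (S := NonUnitalSubalgebra 𝕜 (X →L[𝕜] X)) (cornerEntries_le hI _ _ _ (hf i l))
          (cornerEntries_le hI _ _ _ (hg l j))
      | succ m => exact mul_mem_cornerEntries hI (hf i l) (cornerEntries_succ_le m l j (hg l j))
    rw [blockEntry_mul]
    exact add_mem (h 0) (h 1)

theorem mem_cornerSubalgebra {I : NonUnitalSubalgebra 𝕜 (X →L[𝕜] X)}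
    {hI : IsClosed (I : Set (X →L[𝕜] X))} {m : ℕ} {f : (X × X) →L[𝕜] (X × X)} :
    f ∈ cornerSubalgebra I hI m ↔ ∀ i j, blockEntry i j f ∈ cornerEntries I m i j := Iff.rfl

theorem isClosed_cornerSubalgebra (I : NonUnitalSubalgebra 𝕜 (X →L[𝕜] X))
    (hI : IsClosed (I : Set (X →L[𝕜] X))) (m : ℕ) :
    IsClosed (cornerSubalgebra I hI m : Set ((X × X) →L[𝕜] (X × X))) := by
  have h : (cornerSubalgebra I hI m : Set ((X × X) →L[𝕜] (X × X))) =
      ⋂ i, ⋂ j, blockEntry i j ⁻¹' (cornerEntries I m i j : Set (X →L[𝕜] X)) := by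
    ext f
    simp [mem_cornerSubalgebra]
  rw [h]
  exact isClosed_iInter fun i => isClosed_iInter fun j =>
    (isClosed_cornerEntries hI m i j).preimage (blockEntry i j).continuous

theorem isIdealOf_cornerSubalgebra_succ (I : NonUnitalSubalgebra 𝕜 (X →L[𝕜] X))
    (hI : IsClosed (I : Set (X →L[𝕜] X))) (m : ℕ) :
    IsIdealOf (cornerSubalgebra I hI (m + 1)) (cornerSubalgebra I hI m) := by
  refine ⟨fun f hf i j => cornerEntries_succ_le m i j (hf i j),
    fun a ha x hx => ⟨fun i j => ?_, fun i j => ?_⟩⟩ <;> rw [blockEntry_mul]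
  · exact add_mem (cornerEntries_mul_mem hI (ha i 0) (hx 0 j))
      (cornerEntries_mul_mem hI (ha i 1) (hx 1 j))
  · exact add_mem (mul_mem_cornerEntries hI (hx i 0) (ha 0 j))
      (mul_mem_cornerEntries hI (hx i 1) (ha 1 j))

theorem isIdealOf_cornerSubalgebra_zero_top (I : NonUnitalSubalgebra 𝕜 (X →L[𝕜] X))
    (hI : IsClosed (I : Set (X →L[𝕜] X)))
    (hIideal : ∀ a : X →L[𝕜] X, ∀ x ∈ I, a * x ∈ I ∧ x * a ∈ I) :
    IsIdealOf (cornerSubalgebra I hI 0) ⊤ := by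
  refine ⟨fun f _ => NonUnitalAlgebra.mem_top,
    fun a _ x hx => ⟨fun i j => ?_, fun i j => ?_⟩⟩ <;>
  · have hx' (k l : Fin 2) : blockEntry k l x ∈ I := cornerEntries_le hI 0 k l (hx k l)
    rw [blockEntry_mul, cornerEntries_zero hI]
    first
    | exact add_mem (S := NonUnitalSubalgebra 𝕜 (X →L[𝕜] X)) (hIideal _ _ (hx' 0 j)).1
        (hIideal _ _ (hx' 1 j)).1
    | exact add_mem (S := NonUnitalSubalgebra 𝕜 (X →L[𝕜] X)) (hIideal _ _ (hx' i 0)).2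
        (hIideal _ _ (hx' i 1)).2

theorem isClosedNSubideal_cornerSubalgebra (I : NonUnitalSubalgebra 𝕜 (X →L[𝕜] X))
    (hI : IsClosed (I : Set (X →L[𝕜] X)))
    (hIideal : ∀ a : X →L[𝕜] X, ∀ x ∈ I, a * x ∈ I ∧ x * a ∈ I) (n : ℕ) :
    IsClosedNSubideal 𝕜 (n + 1)
      (cornerSubalgebra I hI n : Set ((X × X) →L[𝕜] (X × X))) := by
  refine ⟨fun k => Nat.casesOn (motive := fun _ => NonUnitalSubalgebra 𝕜 ((X × X) →L[𝕜] (X × X)))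
    k ⊤ (cornerSubalgebra I hI), NonUnitalAlgebra.coe_top, rfl, ?_, ?_⟩
  · rintro (_ | k) -
    · change IsClosed
        ((⊤ : NonUnitalSubalgebra 𝕜 ((X × X) →L[𝕜] (X × X))) : Set ((X × X) →L[𝕜] (X × X)))
      rw [NonUnitalAlgebra.coe_top]
      exact isClosed_univ
    · exact isClosed_cornerSubalgebra I hI k
  · rintro (_ | k) -
    · exact isIdealOf_cornerSubalgebra_zero_top I hI hIideal
    · exact isIdealOf_cornerSubalgebra_succ I hI k

theorem IsClosedNSubideal.singleBlock_pow_mem {n : ℕ} (hn : 1 ≤ n)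
    {M : Set ((X × X) →L[𝕜] (X × X))} (hM : IsClosedNSubideal 𝕜 n M) {S : X →L[𝕜] X}
    (hS : singleBlock 0 0 S ∈ M) : singleBlock 0 1 (S ^ n) ∈ M := by
  obtain ⟨C, hC0, hCn, -, hC⟩ := hM
  have hT : ∀ k ≤ n, singleBlock 0 0 S ∈ C k := fun k hk =>
    Nat.decreasingInduction (motive := fun k _ => singleBlock 0 0 S ∈ C k)
      (fun m hm h => (hC m hm).1 h) (by rwa [← SetLike.mem_coe, hCn]) hk
  have hpow : ∀ k < n, singleBlock 0 1 (S ^ (k + 1)) ∈ C (k + 1) := by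
    intro k
    induction k with
    | zero =>
      intro hk
      have h1 : singleBlock 0 1 (1 : X →L[𝕜] X) ∈ C 0 := by
        rw [← SetLike.mem_coe, hC0]
        trivial
      have h := ((hC 0 hk).2 _ h1 _ (hT 1 hk)).2
      rwa [singleBlock_mul_singleBlock, mul_one, ← pow_one S] at h
    | succ k ih =>
      intro hk
      have h := ((hC (k + 1) hk).2 _ (ih (Nat.lt_of_succ_lt hk)) _ (hT (k + 2) hk)).2
      rwa [singleBlock_mul_singleBlock, ← pow_succ'] at h
  obtain ⟨k, rfl⟩ := Nat.exists_eq_add_of_le' hn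
  rw [← hCn]
  exact hpow k (Nat.lt_succ_self k)

end BlockOperators

/-- Let `n ∈ ℕ` and let `X` be a Banach space for which there exist a
closed two-sided ideal `I` of `L(X)` and `S ∈ I` with `S^n ∉ closure (I^{n+1})`, where
`I^{n+1}` is the linear span of all products of `n + 1` elements of `I`.  Then, for
`Z = X ⊕ X`, there is a closed subalgebra of `L(Z)` which is a closed `(n+1)`-subideal of
`L(Z)` but not a closed `n`-subideal of `L(Z)`. -/
theorem exists_closed_succ_subideal_not_nsubideal
    {𝕜 X : Type*} [RCLike 𝕜] [NormedAddCommGroup X] [NormedSpace 𝕜 X] [CompleteSpace X]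
    (n : ℕ) (hn : 1 ≤ n)
    (I : NonUnitalSubalgebra 𝕜 (X →L[𝕜] X))
    (hIclosed : IsClosed (I : Set (X →L[𝕜] X)))
    (hIideal : ∀ a : X →L[𝕜] X, ∀ x ∈ I, a * x ∈ I ∧ x * a ∈ I)
    (S : X →L[𝕜] X) (hSI : S ∈ I)
    (hS : S ^ n ∉
      closure ((Submodule.span 𝕜 (prodsOf (I : Set (X →L[𝕜] X)) n) : Submodule 𝕜 (X →L[𝕜] X)) :
        Set (X →L[𝕜] X))) :
    ∃ M : Set ((X × X) →L[𝕜] (X × X)),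
      IsClosedNSubideal 𝕜 (n + 1) M ∧ ¬IsClosedNSubideal 𝕜 n M := by
  refine ⟨cornerSubalgebra I hIclosed n,
    isClosedNSubideal_cornerSubalgebra I hIclosed hIideal n, fun hM => hS ?_⟩
  have hT : singleBlock 0 0 S ∈ cornerSubalgebra I hIclosed n := by
    intro i j
    by_cases h : i = 0 ∧ j = 0
    · obtain ⟨rfl, rfl⟩ := h
      rw [blockEntry_singleBlock]
      exact hSI
    · rw [blockEntry_singleBlock_of_ne h]
      exact zero_mem _
  have h : blockEntry 0 1 (singleBlock 0 1 (S ^ n)) ∈ cornerEntries I n 0 1 :=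
    hM.singleBlock_pow_mem hn hT 0 1
  rwa [blockEntry_singleBlock] at h

end
end

section
/- Let n ∈ ℕ and let M be a closed subalgebra of a Banach algebra A. If M is a closed n-subideal of A, then s·tⁿ ∈ M for all s ∈ A and t ∈ M. -/
open Filter Topology

noncomputable section

/-- `powS t n = t ^ n` for `n ≥ 1` (with junk value `t` at `n = 0`), defined in a
possibly non-unital algebra. -/
def powS {A : Type*} [Mul A] (t : A) : ℕ → A
  | 0 => t
  | 1 => t
  | n + 2 => powS t (n + 1) * t

/-- The terms of a descending chain of ideals are contained in the earlier terms. -/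
theorem mem_of_mem_of_isIdealOf_chain {𝕜 A : Type*} [CommSemiring 𝕜]
    [NonUnitalNonAssocSemiring A] [Module 𝕜 A] {C : ℕ → NonUnitalSubalgebra 𝕜 A} {n : ℕ}
    (hC : ∀ k < n, IsIdealOf (C (k + 1)) (C k)) {t : A} (ht : t ∈ C n) {k : ℕ} (hk : k ≤ n) :
    t ∈ C k := by
  induction hk using Nat.decreasingInduction with
  | self => exact ht
  | of_succ k hk ih => exact (hC k hk).1 ih

/-- In a descending chain of ideals starting at the whole algebra, left multiples of the `k`-th
power of an element of the last term lie in the `k`-th term. -/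
theorem mul_powS_mem_of_isIdealOf_chain {𝕜 A : Type*} [CommSemiring 𝕜]
    [NonUnitalSemiring A] [Module 𝕜 A] {C : ℕ → NonUnitalSubalgebra 𝕜 A} {n : ℕ}
    (h0 : (C 0 : Set A) = Set.univ) (hC : ∀ k < n, IsIdealOf (C (k + 1)) (C k))
    (s : A) {t : A} (ht : t ∈ C n) {k : ℕ} (hk : k ≤ n) : s * powS t k ∈ C k := by
  have h0' (a : A) : a ∈ C 0 := by
    rw [← SetLike.mem_coe, h0]
    exact Set.mem_univ a
  induction k with
  | zero => exact h0' _
  | succ k ih =>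
    have htk := mem_of_mem_of_isIdealOf_chain hC ht hk
    cases k with
    | zero => exact ((hC 0 hk).2 s (h0' s) t htk).1
    | succ k =>
      rw [powS, ← mul_assoc]
      exact ((hC (k + 1) hk).2 _ (ih (by lia)) t htk).1

/-- Let `n ∈ ℕ` and let `M` be a closed subalgebra of a Banach algebra
`A`.  If `M` is a closed `n`-subideal of `A`, then `s · tⁿ ∈ M` for all `s ∈ A` and
`t ∈ M`. -/
theorem smul_pow_mem_of_closed_nsubideal
    {𝕜 A : Type*} [RCLike 𝕜] [NonUnitalNormedRing A] [NormedSpace 𝕜 A]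
    [IsScalarTower 𝕜 A A] [SMulCommClass 𝕜 A A] [CompleteSpace A]
    (n : ℕ) (hn : 1 ≤ n) (M : Set A) (hM : IsClosedNSubideal 𝕜 n M) :
    ∀ s : A, ∀ t ∈ M, s * powS t n ∈ M := by
  obtain ⟨C, h0, rfl, -, hC⟩ := hM
  exact fun s t ht ↦ mul_powS_mem_of_isIdealOf_chain h0 hC s ht le_rfl

end
end

section
/- Let n ∈ ℕ, let 1 ≤ p_1 < p_2 < ⋯ < p_{n+1} ≤ ∞, and let X_n = ℓ^{p_1} ⊕ ⋯ ⊕ ℓ^{p_{n+1}} with the max norm (with the convention ℓ^∞ = c0). Then: (i) every product of n+1 strictly singular operators on X_n is compact, so the quotient algebra S(X_n)/K(X_n) is (n+1)-nilpotent, and the operator-norm closure of S(X_n)^{n+1} equals K(X_n); (ii) there exists S ∈ S(X_n) such that S^n ∉ K(X_n); (iii) there exists a closed subalgebra M ⊆ S(X_n) that is a closed (n+1)-subideal of L(X_n) but not a closed n-subideal of L(X_n). -/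
open Filter Topology
open scoped ENNReal

noncomputable section

/-- A strictly singular operator: no restriction to an infinite-dimensional closed
subspace is an isomorphism onto its image (equivalently, bounded below). -/
def IsStrictlySingular {𝕜 X Y : Type*} [NontriviallyNormedField 𝕜] [NormedAddCommGroup X]
    [NormedSpace 𝕜 X] [NormedAddCommGroup Y] [NormedSpace 𝕜 Y] (T : X →L[𝕜] Y) : Prop :=
  ∀ M : Submodule 𝕜 X, IsClosed (M : Set X) → ¬FiniteDimensional 𝕜 M →
    ¬∃ c : ℝ, 0 < c ∧ ∀ x ∈ M, c * ‖x‖ ≤ ‖T x‖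

/-- A bundled carrier with its norm structure. -/
structure BundledSp (𝕜 : Type*) [NontriviallyNormedField 𝕜] where
  carrier : Type
  [grp : NormedAddCommGroup carrier]
  [mod : NormedSpace 𝕜 carrier]

attribute [instance] BundledSp.grp BundledSp.mod

/-- The sequence space `ℓ^p` for `1 ≤ p ≤ ∞`, with the convention `ℓ^∞ = c_0`. -/
def seqSpB (𝕜 : Type) [RCLike 𝕜] (p : ℝ≥0∞) [Fact (1 ≤ p)] : BundledSp 𝕜 :=
  if p = ∞ then ⟨ZeroAtInftyContinuousMap ℕ 𝕜⟩ else ⟨lp (fun _ : ℕ => 𝕜) p⟩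

/-- The sequence space `ℓ^p` (with `ℓ^∞ = c_0`). -/
abbrev seqSp (𝕜 : Type) [RCLike 𝕜] (p : ℝ≥0∞) [Fact (1 ≤ p)] : Type :=
  (seqSpB 𝕜 p).carrier

section LpSum

open scoped NNReal

/-- The `ℓ^p` norm (the supremum if `p = ∞`) of a finite family of nonnegative reals. -/
def lpSum (p : ℝ≥0∞) {κ : Type*} (s : Finset κ) (t : κ → ℝ≥0) : ℝ≥0 :=
  if p = ∞ then s.sup t else (∑ k ∈ s, t k ^ p.toReal) ^ (p.toReal)⁻¹

variable {p q : ℝ≥0∞} {κ μ : Type*}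

theorem toReal_pos_of_one_le (hp : 1 ≤ p) (h : p ≠ ∞) : 0 < p.toReal :=
  ENNReal.toReal_pos (zero_lt_one.trans_le hp).ne' h

theorem lpSum_mono (hp : 1 ≤ p) {s : Finset κ} {t t' : κ → ℝ≥0} (h : ∀ k ∈ s, t k ≤ t' k) :
    lpSum p s t ≤ lpSum p s t' := by
  unfold lpSum
  split_ifs with hi
  · exact Finset.sup_mono_fun h
  · have := toReal_pos_of_one_le hp hi
    gcongr with k hk
    exact h k hk

theorem lpSum_le_of_subset (hp : 1 ≤ p) {s s' : Finset κ} (h : s ⊆ s') (t : κ → ℝ≥0) :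
    lpSum p s t ≤ lpSum p s' t := by
  unfold lpSum
  split_ifs with hi
  · exact Finset.sup_mono h
  · have := toReal_pos_of_one_le hp hi
    gcongr

theorem lpSum_singleton (hp : 1 ≤ p) (k : κ) (t : κ → ℝ≥0) : lpSum p {k} t = t k := by
  unfold lpSum
  split_ifs with hi
  · simp
  · have := toReal_pos_of_one_le hp hi
    simp [NNReal.rpow_rpow_inv this.ne']

theorem le_lpSum (hp : 1 ≤ p) {s : Finset κ} {k : κ} (hk : k ∈ s) (t : κ → ℝ≥0) :
    t k ≤ lpSum p s t := by
  rw [← lpSum_singleton hp k t]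
  exact lpSum_le_of_subset hp (by simpa using hk) t

theorem lpSum_const (hp : 1 ≤ p) {s : Finset κ} (hs : s.Nonempty) (c : ℝ≥0) :
    lpSum p s (fun _ => c) = c * (s.card : ℝ≥0) ^ (p.toReal)⁻¹ := by
  unfold lpSum
  split_ifs with hi
  · simp [hi, Finset.sup_const hs]
  · have := toReal_pos_of_one_le hp hi
    rw [Finset.sum_const, nsmul_eq_mul, NNReal.mul_rpow, NNReal.rpow_rpow_inv this.ne', mul_comm]

theorem lpSum_mul (hp : 1 ≤ p) (s : Finset κ) (c : ℝ≥0) (t : κ → ℝ≥0) :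
    lpSum p s (fun k => c * t k) = c * lpSum p s t := by
  unfold lpSum
  split_ifs with hi
  · exact (NNReal.mul_finset_sup _ _ _).symm
  · have := toReal_pos_of_one_le hp hi
    simp_rw [NNReal.mul_rpow]
    rw [← Finset.mul_sum, NNReal.mul_rpow, NNReal.rpow_rpow_inv this.ne']

theorem lpSum_sigma (hp : 1 ≤ p) {σ : κ → Type*} (s : Finset κ) (A : ∀ k, Finset (σ k))
    (t : (Σ k, σ k) → ℝ≥0) :
    lpSum p (s.sigma A) t = lpSum p s (fun k => lpSum p (A k) (fun l => t ⟨k, l⟩)) := by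
  unfold lpSum
  split_ifs with hi
  · exact Finset.sup_sigma _ _ _
  · have := toReal_pos_of_one_le hp hi
    simp_rw [NNReal.rpow_inv_rpow this.ne']
    rw [Finset.sum_sigma]

theorem lpSum_image [DecidableEq μ] (s : Finset κ) {σ : κ → μ} (hσ : Set.InjOn σ s)
    (t : μ → ℝ≥0) : lpSum p (s.image σ) t = lpSum p s (fun k => t (σ k)) := by
  unfold lpSum
  split_ifs with hi
  · exact Finset.sup_image _ _ _
  · rw [Finset.sum_image hσ]

theorem lpSum_anti (hp : 1 ≤ p) (hpq : p ≤ q) (s : Finset κ) (t : κ → ℝ≥0) :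
    lpSum q s t ≤ lpSum p s t := by
  rcases eq_or_ne q ∞ with rfl | hq
  · conv_lhs => unfold lpSum
    simp only [if_true]
    exact Finset.sup_le fun k hk => le_lpSum hp hk t
  · have hp' : p ≠ ∞ := ne_top_of_le_ne_top hq hpq
    have h0 := toReal_pos_of_one_le hp hp'
    have h1 := toReal_pos_of_one_le (hp.trans hpq) hq
    have h2 : p.toReal ≤ q.toReal := ENNReal.toReal_mono hq hpq
    set D := lpSum p s t with hD
    have hDp : D ^ p.toReal = ∑ k ∈ s, t k ^ p.toReal := by
      rw [hD, lpSum, if_neg hp', NNReal.rpow_inv_rpow h0.ne']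
    rw [lpSum, if_neg hq, NNReal.rpow_inv_le_iff h1]
    have h3 : q.toReal = (q.toReal - p.toReal) + p.toReal := by ring
    have h4 : ∀ x : ℝ≥0, x ^ q.toReal = x ^ (q.toReal - p.toReal) * x ^ p.toReal := by
      intro x
      conv_lhs => rw [h3]
      exact NNReal.rpow_add_of_nonneg _ (by linarith) h0.le
    rw [h4 D, hDp, Finset.mul_sum]
    refine Finset.sum_le_sum fun k hk => ?_
    rw [h4]
    have := le_lpSum hp hk t
    gcongr

end LpSum

section BasisModel

open scoped NNReal

/-- A Schauder basis of `E` whose finite combinations are normed as in `ℓ^p`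
(as in `c₀` if `p = ∞`). -/
structure LpBasis (𝕜 : Type*) [RCLike 𝕜] (p : ℝ≥0∞) (E : Type*) [NormedAddCommGroup E]
    [NormedSpace 𝕜 E] where
  coord : ℕ → E →L[𝕜] 𝕜
  e : ℕ → E
  coord_e : ∀ k l, coord k (e l) = if k = l then 1 else 0
  tendsto : ∀ x, Tendsto (fun N => ∑ k ∈ Finset.range N, coord k x • e k) atTop (𝓝 x)
  norm_sum : ∀ (s : Finset ℕ) (a : ℕ → 𝕜), ‖∑ k ∈ s, a k • e k‖₊ = lpSum p s (fun k => ‖a k‖₊)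

namespace LpBasis

variable {𝕜 : Type*} [RCLike 𝕜] {p q : ℝ≥0∞} {E F G : Type*} [NormedAddCommGroup E]
  [NormedSpace 𝕜 E] [NormedAddCommGroup F] [NormedSpace 𝕜 F] [NormedAddCommGroup G]
  [NormedSpace 𝕜 G]

theorem nnnorm_sum_injOn (B : LpBasis 𝕜 p E) {κ : Type*} (s : Finset κ) {σ : κ → ℕ}
    (hσ : Set.InjOn σ s) (a : κ → 𝕜) :
    ‖∑ k ∈ s, a k • B.e (σ k)‖₊ = lpSum p s (fun k => ‖a k‖₊) := by
  classical
  rcases isEmpty_or_nonempty κ with hκ | hκ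
  · have : s = ∅ := Finset.eq_empty_of_isEmpty s
    subst this
    simpa [lpSum] using B.norm_sum ∅ 0
  have hinv : ∀ k ∈ s, Function.invFunOn σ s (σ k) = k := fun k hk =>
    hσ.leftInvOn_invFunOn (by simpa using hk)
  have h := B.norm_sum (s.image σ) (fun l => a (Function.invFunOn σ s l))
  rw [Finset.sum_image hσ, lpSum_image s hσ] at h
  rw [Finset.sum_congr rfl (fun k hk => by rw [hinv k hk])] at h
  rw [h]
  have : ∀ p : ℝ≥0∞, ∀ t t' : κ → ℝ≥0, (∀ k ∈ s, t k = t' k) → lpSum p s t = lpSum p s t' := by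
    intro p t t' h
    unfold lpSum
    split_ifs
    · exact Finset.sup_congr rfl h
    · rw [Finset.sum_congr rfl fun k hk => by rw [h k hk]]
  exact this _ _ _ fun k hk => by rw [hinv k hk]

/-- The component of a vector along the basis vectors with index in `[a, b)`. -/
def block (B : LpBasis 𝕜 p E) (a b : ℕ) : E →L[𝕜] E :=
  ∑ k ∈ Finset.Ico a b, (B.coord k).smulRight (B.e k)

theorem block_apply (B : LpBasis 𝕜 p E) (a b : ℕ) (x : E) :
    B.block a b x = ∑ k ∈ Finset.Ico a b, B.coord k x • B.e k := by
  simp [block]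

theorem tendsto_block (B : LpBasis 𝕜 p E) (x : E) :
    Tendsto (fun N => B.block 0 N x) atTop (𝓝 x) := by
  simpa [block_apply] using B.tendsto x

theorem block_sub_block (B : LpBasis 𝕜 p E) {a b : ℕ} (h : a ≤ b) :
    B.block 0 b - B.block 0 a = B.block a b := by
  rw [block, block, block, sub_eq_iff_eq_add, add_comm, Finset.sum_Ico_consecutive _ (Nat.zero_le _) h]

theorem norm_block_le (B : LpBasis 𝕜 p E) (hp : 1 ≤ p) (a b : ℕ) (x : E) :
    ‖B.block a b x‖ ≤ ‖x‖ := by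
  refine ge_of_tendsto (B.tendsto_block x).norm ?_
  filter_upwards [eventually_ge_atTop b] with N hN
  rw [block_apply, block_apply]
  have := lpSum_le_of_subset hp (Finset.Ico_subset_Ico (Nat.zero_le a) hN)
    (fun k => ‖B.coord k x‖₊)
  rw [← B.norm_sum, ← B.norm_sum] at this
  exact_mod_cast this

theorem ext_e (B : LpBasis 𝕜 p E) {S T : E →L[𝕜] G} (h : ∀ k, S (B.e k) = T (B.e k)) : S = T := by
  ext x
  refine tendsto_nhds_unique ((S.continuous.tendsto x).comp (B.tendsto x)) ?_
  refine ((T.continuous.tendsto x).comp (B.tendsto x)).congr fun N => ?_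
  simp [h]

theorem norm_e (B : LpBasis 𝕜 p E) (hp : 1 ≤ p) (k : ℕ) : ‖B.e k‖ = 1 := by
  have h1 := B.norm_sum {k} (fun _ => 1)
  rw [lpSum_singleton hp] at h1
  simpa [← NNReal.coe_inj] using h1

theorem exists_map_e [CompleteSpace E] [CompleteSpace F] (B : LpBasis 𝕜 p E)
    (B' : LpBasis 𝕜 q F) (hp : 1 ≤ p) (hpq : p ≤ q) {σ : ℕ → ℕ} (hσ : Function.Injective σ) :
    ∃ R : E →L[𝕜] F, ∀ k, R (B.e k) = B'.e (σ k) := by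
  set g : ℕ → E →L[𝕜] F := fun N => ∑ k ∈ Finset.range N, (B.coord k).smulRight (B'.e (σ k))
  have hg : ∀ N x, g N x = ∑ k ∈ Finset.range N, B.coord k x • B'.e (σ k) := by
    intro N x
    simp [g]
  have hC : ∀ x, ∃ y, Tendsto (fun N => g N x) atTop (𝓝 y) := by
    intro x
    refine cauchySeq_tendsto_of_complete ?_
    have hx := (B.tendsto x).cauchySeq
    rw [Metric.cauchySeq_iff'] at hx ⊢
    intro ε hε
    obtain ⟨N, hN⟩ := hx ε hε
    refine ⟨N, fun n hn => lt_of_le_of_lt ?_ (hN n hn)⟩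
    rw [dist_eq_norm, dist_eq_norm, hg, hg, ← Finset.sum_Ico_eq_sub _ hn,
      ← Finset.sum_Ico_eq_sub _ hn]
    have := lpSum_anti hp hpq (Finset.Ico N n) (fun k => ‖B.coord k x‖₊)
    rw [← B.norm_sum, ← B'.nnnorm_sum_injOn _ hσ.injOn] at this
    exact_mod_cast this
  choose f hf using hC
  refine ⟨continuousLinearMapOfTendsto g (tendsto_pi_nhds.2 hf), fun k => ?_⟩
  refine tendsto_nhds_unique (hf (B.e k)) ?_
  refine tendsto_const_nhds.congr' ?_
  filter_upwards [eventually_gt_atTop k] with N hN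
  rw [hg, Finset.sum_eq_single k]
  · simp [B.coord_e]
  · intro l _ hl
    simp [B.coord_e, hl]
  · intro h
    exact absurd (Finset.mem_range.2 hN) h

theorem isCompactOperator_block (B : LpBasis 𝕜 p E) (a b : ℕ) :
    IsCompactOperator (B.block a b) := by
  have : B.block a b ∈ compactOperator (RingHom.id 𝕜) E E := by
    refine Submodule.sum_mem _ fun k _ => ?_
    have h : IsCompactOperator (B.coord k) :=
      isCompactOperator_of_locallyCompactSpace_dom (B.coord k)
    exact h.clm_comp (ContinuousLinearMap.toSpanSingleton 𝕜 (B.e k))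
  exact this

/-- Norm of a sum of disjoint blocks. -/
theorem nnnorm_sum_block (B : LpBasis 𝕜 p E) (hp : 1 ≤ p) {m : ℕ → ℕ} (hm : StrictMono m)
    (u : ℕ → E) (c : ℕ → 𝕜) (s : Finset ℕ) :
    ‖∑ k ∈ s, c k • B.block (m k) (m (k + 1)) (u k)‖₊ =
      lpSum p s (fun k => ‖c k‖₊ * ‖B.block (m k) (m (k + 1)) (u k)‖₊) := by
  have hinj : Set.InjOn (fun z : (_ : ℕ) × ℕ => z.2)
      (s.sigma fun k => Finset.Ico (m k) (m (k + 1))) := by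
    rintro ⟨k, i⟩ hki ⟨l, j⟩ hlj hij
    simp only [Finset.coe_sigma, Set.mem_sigma_iff, Finset.mem_coe, Finset.mem_Ico] at hki hlj hij
    subst hij
    have h1 : k < l + 1 := hm.lt_iff_lt.1 (by omega)
    have h2 : l < k + 1 := hm.lt_iff_lt.1 (by omega)
    obtain rfl : k = l := by omega
    rfl
  have h := B.nnnorm_sum_injOn _ hinj (fun z => c z.1 * B.coord z.2 (u z.1))
  rw [Finset.sum_sigma, lpSum_sigma hp] at h
  simp only [nnnorm_mul, lpSum_mul hp, mul_smul, ← Finset.smul_sum, ← block_apply,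
    ← B.norm_sum] at h
  exact h

end LpBasis

end BasisModel

section Selection

variable {𝕜 : Type*} [RCLike 𝕜] {E F G : Type*} [NormedAddCommGroup E]
  [NormedSpace 𝕜 E] [NormedAddCommGroup F] [NormedSpace 𝕜 F] [NormedAddCommGroup G]
  [NormedSpace 𝕜 G]

/-- A bounded sequence has a subsequence whose images under countably many compact operators
are Cauchy. -/
theorem exists_subseq_cauchySeq (Q : ℕ → E →L[𝕜] G) (hQ : ∀ N, IsCompactOperator (Q N))
    {x : ℕ → E} {r : ℝ} (hx : ∀ k, ‖x k‖ ≤ r) :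
    ∃ φ : ℕ → ℕ, StrictMono φ ∧ ∀ N, CauchySeq fun k => Q N (x (φ k)) := by
  have hK : IsCompact (Set.pi Set.univ fun N => closure (Q N '' Metric.closedBall 0 r)) :=
    isCompact_univ_pi fun N =>
      IsCompactOperator.isCompact_closure_image_closedBall (f := (Q N).toLinearMap) (hQ N) r
  obtain ⟨a, -, φ, hφ, ha⟩ := hK.isSeqCompact (x := fun k N => Q N (x k)) fun k N _ =>
    subset_closure ⟨x k, by simpa using hx k, rfl⟩
  exact ⟨φ, hφ, fun N => (tendsto_pi_nhds.1 ha N).cauchySeq⟩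

theorem CauchySeq.eventually_norm_sub_le {y : ℕ → E} (hy : CauchySeq y) {δ : ℝ} (hδ : 0 < δ) :
    ∀ᶠ n in atTop, ‖y (n + 1) - y n‖ ≤ δ := by
  obtain ⟨N, hN⟩ := Metric.cauchySeq_iff.1 hy δ hδ
  filter_upwards [eventually_ge_atTop N] with n hn
  rw [← dist_eq_norm]
  exact (hN _ (by omega) _ hn).le

/-- A bounded sequence has differences that are small perturbations of a block sequence, whose
images under `T` are too, and which are nearly annihilated by the compact operator `C`. -/
theorem exists_block_differences (P : ℕ → E →L[𝕜] E) (hP : ∀ N, IsCompactOperator (P N))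
    (hPt : ∀ x, Tendsto (fun N => P N x) atTop (𝓝 x))
    (P' : ℕ → F →L[𝕜] F) (hP' : ∀ N, IsCompactOperator (P' N))
    (hPt' : ∀ x, Tendsto (fun N => P' N x) atTop (𝓝 x)) (T : E →L[𝕜] F) (C : E →L[𝕜] G)
    (hC : IsCompactOperator C) {x : ℕ → E} {r : ℝ} (hx : ∀ k, ‖x k‖ ≤ r) {ε : ℕ → ℝ}
    (hε : ∀ k, 0 < ε k) :
    ∃ (u : ℕ → E) (m : ℕ → ℕ), StrictMono m ∧ (∀ k, ∃ a b, a ≠ b ∧ u k = x b - x a) ∧ ∀ k,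
      ‖u k - (P (m (k + 1)) - P (m k)) (u k)‖ ≤ ε k ∧
      ‖T (u k) - (P' (m (k + 1)) - P' (m k)) (T (u k))‖ ≤ ε k ∧ ‖C (u k)‖ ≤ ε k := by
  obtain ⟨φ, hφ, h1⟩ := exists_subseq_cauchySeq P hP hx
  obtain ⟨ψ, hψ, h2⟩ := exists_subseq_cauchySeq (fun N => (P' N).comp T)
    (fun N => (hP' N).comp_clm T) (fun k => hx (φ k))
  obtain ⟨χ, hχ, h3⟩ := exists_subseq_cauchySeq (fun _ => C) (fun _ => hC)
    (fun k => hx (φ (ψ k)))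
  replace h1 := fun N => (h1 N).comp_tendsto (hψ.comp hχ).tendsto_atTop
  replace h2 := fun N => (h2 N).comp_tendsto hχ.tendsto_atTop
  replace h3 := h3 0
  have step : ∀ (k m : ℕ), ∃ (u : E) (m' : ℕ), m < m' ∧ (∃ a b, a ≠ b ∧ u = x b - x a) ∧
      ‖u - (P m' - P m) u‖ ≤ ε k ∧ ‖T u - (P' m' - P' m) (T u)‖ ≤ ε k ∧ ‖C u‖ ≤ ε k := by
    intro k m
    have hk := half_pos (hε k)
    obtain ⟨n, hn1, hn2, hn3⟩ := (((h1 m).eventually_norm_sub_le hk).and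
      (((h2 m).eventually_norm_sub_le hk).and (h3.eventually_norm_sub_le (hε k)))).exists
    simp only [Function.comp_apply, ← map_sub, ContinuousLinearMap.comp_apply] at hn1 hn2 hn3
    set u := x (φ (ψ (χ (n + 1)))) - x (φ (ψ (χ n))) with hu
    have e1 := (tendsto_iff_norm_sub_tendsto_zero.1 (hPt u)).eventually (ge_mem_nhds hk)
    have e2 := (tendsto_iff_norm_sub_tendsto_zero.1 (hPt' (T u))).eventually (ge_mem_nhds hk)
    obtain ⟨m', hm1, hm2, hm3⟩ := (e1.and (e2.and (eventually_gt_atTop m))).exists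
    refine ⟨u, m', hm3, ⟨_, _, ?_, hu⟩, ?_, ?_, hn3⟩
    · exact fun h => by
        have := hχ.injective (hψ.injective (hφ.injective h))
        omega
    · have : u - (P m' - P m) u = P m u - (P m' u - u) := by
        simp only [sub_apply]; abel
      rw [this]
      exact (norm_sub_le _ _).trans (by linarith)
    · have : T u - (P' m' - P' m) (T u) = P' m (T u) - (P' m' (T u) - T u) := by
        simp only [sub_apply]; abel
      rw [this]
      exact (norm_sub_le _ _).trans (by linarith)
  choose U M hM hU hest using step
  let m : ℕ → ℕ := fun k => Nat.rec 0 (fun k m => M k m) k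
  exact ⟨fun k => U k (m k), m, strictMono_nat_of_lt_succ fun k => hM k (m k),
    fun k => hU k (m k), fun k => hest k (m k)⟩

theorem exists_separated_of_not_isCompactOperator [CompleteSpace F] (T : E →L[𝕜] F)
    (hT : ¬IsCompactOperator T) :
    ∃ δ > 0, ∃ x : ℕ → E, (∀ k, ‖x k‖ ≤ 1) ∧ ∀ a b, a ≠ b → δ ≤ ‖T (x b - x a)‖ := by
  have h1 : ¬TotallyBounded (T '' Metric.closedBall 0 1) := by
    intro h
    refine hT ((isCompactOperator_iff_isCompact_closure_image_closedBall T.toLinearMap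
      zero_lt_one).2 ?_)
    exact isCompact_iff_totallyBounded_isComplete.2 ⟨h.closure, isClosed_closure.isComplete⟩
  rw [Metric.totallyBounded_iff] at h1
  push Not at h1
  obtain ⟨δ, hδ, h⟩ := h1
  classical
  obtain ⟨x, hx, hsep⟩ := exists_seq_of_forall_finset_exists (fun x : E => ‖x‖ ≤ 1)
    (fun x y => δ ≤ ‖T (y - x)‖) (by
      intro s _
      have := h (s.image T) (Finset.finite_toSet _)
      rw [Set.not_subset] at this
      obtain ⟨_, ⟨y, hy, rfl⟩, hy'⟩ := this
      refine ⟨y, by simpa using hy, fun z hz => ?_⟩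
      by_contra hlt
      refine hy' (Set.mem_iUnion₂.2 ⟨T z, by simpa using ⟨z, hz, rfl⟩, ?_⟩)
      rw [Metric.mem_ball, dist_eq_norm, ← map_sub]
      exact not_le.1 hlt)
  refine ⟨δ, hδ, x, hx, fun a b hab => ?_⟩
  rcases hab.lt_or_gt with h | h
  · exact hsep a b h
  · have := hsep b a h
    rwa [← neg_sub, map_neg, norm_neg] at this

theorem not_isCompactOperator_of_separated (T : E →L[𝕜] F) {x : ℕ → E} {r δ : ℝ}
    (hx : ∀ k, ‖x k‖ ≤ r) (hδ : 0 < δ) (h : ∀ a b, a ≠ b → δ ≤ ‖T (x a) - T (x b)‖) :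
    ¬IsCompactOperator T := by
  intro hT
  obtain ⟨φ, hφ, hc⟩ := exists_subseq_cauchySeq (fun _ => T) (fun _ => hT) hx
  obtain ⟨N, hN⟩ := Metric.cauchySeq_iff'.1 (hc 0) δ hδ
  have h1 := hN (N + 1) (by omega)
  rw [dist_eq_norm] at h1
  exact absurd (h _ _ (hφ.injective.ne (by omega))) (not_le.2 h1)

/-- A strictly singular operator is not bounded below on infinite-dimensional subspaces, closed
or not. -/
theorem IsStrictlySingular.not_bounded_below {T : E →L[𝕜] F} (hT : IsStrictlySingular T)
    (M : Submodule 𝕜 E) (hM : ¬FiniteDimensional 𝕜 M) {c : ℝ} (hc : 0 < c) :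
    ¬∀ x ∈ M, c * ‖x‖ ≤ ‖T x‖ := by
  intro h
  refine hT M.topologicalClosure M.isClosed_topologicalClosure (fun hfin => hM ?_) ⟨c, hc, ?_⟩
  · exact Submodule.finiteDimensional_of_le M.le_topologicalClosure
  · intro x hx
    have hcl : IsClosed {x | c * ‖x‖ ≤ ‖T x‖} :=
      isClosed_le (by fun_prop) (by fun_prop)
    exact closure_minimal (show (M : Set E) ⊆ {x | c * ‖x‖ ≤ ‖T x‖} from h) hcl hx

end Selection

section Growth

theorem not_forall_rpow_le {α β : ℝ} (hβ : 0 ≤ β) (hαβ : β < α) {c : ℝ} (hc : 0 < c) (K d : ℝ) :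
    ¬∀ N : ℕ, 1 ≤ N → c * (N : ℝ) ^ α ≤ K * (N : ℝ) ^ β + d := by
  intro h
  have h1 : Tendsto (fun N : ℕ => (N : ℝ) ^ (α - β)) atTop atTop :=
    (tendsto_rpow_atTop (sub_pos.2 hαβ)).comp tendsto_natCast_atTop_atTop
  obtain ⟨N, hN, hN1⟩ := ((h1.eventually_gt_atTop ((K + |d|) / c)).and
    (eventually_ge_atTop 1)).exists
  have hN0 : (1 : ℝ) ≤ N := by exact_mod_cast hN1
  have h2 := h N hN1
  have h3 : 1 ≤ (N : ℝ) ^ β := Real.one_le_rpow hN0 hβ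
  have h4 : (N : ℝ) ^ α = (N : ℝ) ^ (α - β) * (N : ℝ) ^ β := by
    rw [← Real.rpow_add (by linarith)]
    ring_nf
  rw [div_lt_iff₀ hc] at hN
  have h5 : d ≤ |d| * (N : ℝ) ^ β := (le_abs_self d).trans (le_mul_of_one_le_right (abs_nonneg d) h3)
  have h6 : (K + |d|) * (N : ℝ) ^ β < (N : ℝ) ^ (α - β) * c * (N : ℝ) ^ β :=
    mul_lt_mul_of_pos_right hN (by linarith)
  rw [h4] at h2
  nlinarith

theorem inv_toReal_lt {p q : ℝ≥0∞} (hq : 1 ≤ q) (hqp : q < p) : (p.toReal)⁻¹ < (q.toReal)⁻¹ := by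
  have h1 := toReal_pos_of_one_le hq hqp.ne_top
  rcases eq_or_ne p ∞ with rfl | hp
  · simpa using h1
  · exact inv_strictAnti₀ h1 (ENNReal.toReal_strict_mono hp hqp)

theorem sum_half_pow_le (s : Finset ℕ) : ∑ k ∈ s, (1 / 2 : ℝ) ^ k ≤ 2 := by
  exact (summable_geometric_two.sum_le_tsum s fun _ _ => by positivity).trans
    tsum_geometric_two.le

variable {𝕜 : Type*} [RCLike 𝕜] {p q : ℝ≥0∞} {E F : Type*} [NormedAddCommGroup E]
  [NormedSpace 𝕜 E] [NormedAddCommGroup F] [NormedSpace 𝕜 F]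

theorem norm_sum_smul_sub_le {δ D : ℝ} {v w : ℕ → E}
    (hvw : ∀ k, ‖v k - w k‖ ≤ δ / 8 * (1 / 2) ^ k) {s : Finset ℕ} {a : ℕ → 𝕜}
    (hD : 0 ≤ D) (ha : ∀ k ∈ s, ‖a k‖ * (δ / 2) ≤ D) :
    ‖∑ k ∈ s, a k • v k - ∑ k ∈ s, a k • w k‖ ≤ D / 2 := by
  rw [← Finset.sum_sub_distrib]
  have h1 : ∀ k ∈ s, ‖a k • v k - a k • w k‖ ≤ D / 4 * (1 / 2) ^ k := by
    intro k hk
    rw [← smul_sub, norm_smul]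
    have h2 := mul_le_mul_of_nonneg_left (hvw k) (norm_nonneg (a k))
    have h3 := mul_le_mul_of_nonneg_right (ha k hk)
      (show (0 : ℝ) ≤ 1 / 4 * (1 / 2) ^ k by positivity)
    linarith
  refine (norm_sum_le _ _).trans ((Finset.sum_le_sum h1).trans ?_)
  rw [← Finset.mul_sum]
  have := mul_le_mul_of_nonneg_left (sum_half_pow_le s) (show 0 ≤ D / 4 by positivity)
  linarith

namespace LpBasis

theorem norm_sum_le_of_near_blocks (B : LpBasis 𝕜 p E) (hp : 1 ≤ p) {m : ℕ → ℕ}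
    (hm : StrictMono m) {u : ℕ → E} {ε : ℕ → ℝ}
    (hu : ∀ k, ‖u k - B.block (m k) (m (k + 1)) (u k)‖ ≤ ε k) {s : Finset ℕ}
    (hs : s.Nonempty) {η r : ℝ} (hη : ∑ k ∈ s, ε k ≤ η) (hr : 0 ≤ r) (h : ∀ k ∈ s, ‖u k‖ ≤ r) :
    ‖∑ k ∈ s, u k‖ ≤ r * (s.card : ℝ) ^ (p.toReal)⁻¹ + η := by
  have h1 := B.nnnorm_sum_block hp hm u 1 s
  simp only [Pi.one_apply, one_smul, nnnorm_one, one_mul] at h1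
  have h2 := lpSum_mono hp (s := s) (t := fun k => ‖B.block (m k) (m (k + 1)) (u k)‖₊)
    (t' := fun _ => r.toNNReal) fun k hk => by
      rw [Real.le_toNNReal_iff_coe_le hr]
      exact (B.norm_block_le hp _ _ _).trans (h k hk)
  rw [← h1, lpSum_const hp hs, ← NNReal.coe_le_coe] at h2
  push_cast [Real.coe_toNNReal r hr] at h2
  have h3 : ‖∑ k ∈ s, u k - ∑ k ∈ s, B.block (m k) (m (k + 1)) (u k)‖ ≤ η := by
    rw [← Finset.sum_sub_distrib]
    exact (norm_sum_le _ _).trans ((Finset.sum_le_sum fun k _ => hu k).trans hη)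
  have h4 := norm_sub_norm_le (∑ k ∈ s, u k) (∑ k ∈ s, B.block (m k) (m (k + 1)) (u k))
  linarith

theorem le_norm_sum_of_near_blocks (B : LpBasis 𝕜 p E) (hp : 1 ≤ p) {m : ℕ → ℕ}
    (hm : StrictMono m) {u : ℕ → E} {ε : ℕ → ℝ}
    (hu : ∀ k, ‖u k - B.block (m k) (m (k + 1)) (u k)‖ ≤ ε k) {s : Finset ℕ}
    (hs : s.Nonempty) {η δ : ℝ} (hη : ∑ k ∈ s, ε k ≤ η) (hδ : 0 ≤ δ) (h : ∀ k ∈ s, δ ≤ ‖u k‖)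
    (hε : ∀ k ∈ s, ε k ≤ δ / 2) :
    δ / 2 * (s.card : ℝ) ^ (p.toReal)⁻¹ ≤ ‖∑ k ∈ s, u k‖ + η := by
  have hr : 0 ≤ δ / 2 := by linarith
  have h1 := B.nnnorm_sum_block hp hm u 1 s
  simp only [Pi.one_apply, one_smul, nnnorm_one, one_mul] at h1
  have h2 := lpSum_mono hp (s := s) (t' := fun k => ‖B.block (m k) (m (k + 1)) (u k)‖₊)
    (t := fun _ => (δ / 2).toNNReal) fun k hk => by
      rw [Real.toNNReal_le_iff_le_coe]
      have := norm_sub_norm_le (u k) (B.block (m k) (m (k + 1)) (u k))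
      have := hu k
      have := h k hk
      have := hε k hk
      simp only [coe_nnnorm]
      linarith
  rw [← h1, lpSum_const hp hs, ← NNReal.coe_le_coe] at h2
  push_cast [Real.coe_toNNReal _ hr] at h2
  have h3 : ‖∑ k ∈ s, B.block (m k) (m (k + 1)) (u k) - ∑ k ∈ s, u k‖ ≤ η := by
    rw [← norm_neg, neg_sub, ← Finset.sum_sub_distrib]
    exact (norm_sum_le _ _).trans ((Finset.sum_le_sum fun k _ => hu k).trans hη)
  have h4 := norm_sub_norm_le (∑ k ∈ s, B.block (m k) (m (k + 1)) (u k)) (∑ k ∈ s, u k)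
  linarith

theorem exists_near_block_differences (B : LpBasis 𝕜 p E) (B' : LpBasis 𝕜 q F) (T : E →L[𝕜] F)
    {x : ℕ → E} {r : ℝ} (hx : ∀ k, ‖x k‖ ≤ r) {ε : ℕ → ℝ} (hε : ∀ k, 0 < ε k) :
    ∃ (u : ℕ → E) (m : ℕ → ℕ), StrictMono m ∧ (∀ k, ∃ a b, a ≠ b ∧ u k = x b - x a) ∧
      (∀ k, ‖u k - B.block (m k) (m (k + 1)) (u k)‖ ≤ ε k) ∧
      ∀ k, ‖T (u k) - B'.block (m k) (m (k + 1)) (T (u k))‖ ≤ ε k := by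
  obtain ⟨u, m, hm, hu, h⟩ := exists_block_differences (B.block 0)
    (B.isCompactOperator_block 0) B.tendsto_block (B'.block 0) (B'.isCompactOperator_block 0)
    B'.tendsto_block T (0 : E →L[𝕜] E) isCompactOperator_zero hx hε
  simp only [B.block_sub_block (hm (Nat.lt_succ_self _)).le,
    B'.block_sub_block (hm (Nat.lt_succ_self _)).le] at h
  exact ⟨u, m, hm, hu, fun k => (h k).1, fun k => (h k).2.1⟩

/-- **Pitt's theorem**. -/
theorem isCompactOperator_of_lt [CompleteSpace F] (B : LpBasis 𝕜 p E) (B' : LpBasis 𝕜 q F)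
    (hq : 1 ≤ q) (hqp : q < p) (T : E →L[𝕜] F) : IsCompactOperator T := by
  by_contra hT
  have hp : 1 ≤ p := hq.trans hqp.le
  obtain ⟨δ, hδ, x, hx, hsep⟩ := exists_separated_of_not_isCompactOperator T hT
  obtain ⟨u, m, hm, hu, hB, hB'⟩ := B.exists_near_block_differences B' T hx
    (ε := fun k => (1 / 2) ^ k) fun k => by positivity
  have hu2 : ∀ k, ‖u k‖ ≤ 2 := fun k => by
    obtain ⟨a, b, -, h⟩ := hu k
    rw [h]
    exact (norm_sub_le _ _).trans (by linarith [hx a, hx b])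
  have hTu : ∀ k, δ ≤ ‖T (u k)‖ := fun k => by
    obtain ⟨a, b, hab, h⟩ := hu k
    rw [h]
    exact hsep a b hab
  obtain ⟨K, hK⟩ := ((tendsto_pow_atTop_nhds_zero_of_lt_one (r := (1 / 2 : ℝ)) (by norm_num)
    (by norm_num)).eventually (ge_mem_nhds (half_pos hδ))).exists_forall_of_atTop
  refine not_forall_rpow_le (inv_nonneg.2 ENNReal.toReal_nonneg) (inv_toReal_lt hq hqp)
    (half_pos hδ) (‖T‖ * 2) (‖T‖ * 2 + 2) fun N hN => ?_
  have hs : (Finset.Ico K (K + N)).Nonempty := by simpa using Nat.pos_of_ne_zero (by omega)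
  have h1 := B.norm_sum_le_of_near_blocks hp hm hB hs (sum_half_pow_le _) zero_le_two
    fun k _ => hu2 k
  have h2 := B'.le_norm_sum_of_near_blocks hq hm hB' hs (sum_half_pow_le _) hδ.le
    (fun k _ => hTu k) fun k hk => hK k (Finset.mem_Ico.1 hk).1
  simp only [Nat.card_Ico, add_tsub_cancel_left, ← map_sum] at h1 h2
  have h3 := T.le_opNorm (∑ k ∈ Finset.Ico K (K + N), u k)
  have h4 := mul_le_mul_of_nonneg_left h1 (norm_nonneg T)
  linarith

/-- Strictly singular operators between spaces of the same exponent are compact. -/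
theorem isCompactOperator_of_isStrictlySingular [CompleteSpace F] (B : LpBasis 𝕜 p E)
    (B' : LpBasis 𝕜 p F) (hp : 1 ≤ p) {T : E →L[𝕜] F} (hT : IsStrictlySingular T) :
    IsCompactOperator T := by
  by_contra hTc
  obtain ⟨δ, hδ, x, hx, hsep⟩ := exists_separated_of_not_isCompactOperator T hTc
  obtain ⟨u, m, hm, hu, hB, hB'⟩ := B.exists_near_block_differences B' T hx
    (ε := fun k => δ / 8 * (1 / 2) ^ k) fun k => by positivity
  have hu2 : ∀ k, ‖u k‖ ≤ 2 := fun k => by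
    obtain ⟨a, b, -, h⟩ := hu k
    rw [h]
    exact (norm_sub_le _ _).trans (by linarith [hx a, hx b])
  have hTu : ∀ k, δ ≤ ‖T (u k)‖ := fun k => by
    obtain ⟨a, b, hab, h⟩ := hu k
    rw [h]
    exact hsep a b hab
  have hd : ∀ k, δ / 2 ≤ ‖B'.block (m k) (m (k + 1)) (T (u k))‖ := fun k => by
    have h1 := norm_sub_norm_le (T (u k)) (B'.block (m k) (m (k + 1)) (T (u k)))
    have h2 : δ / 8 * (1 / 2 : ℝ) ^ k ≤ δ / 8 :=
      mul_le_of_le_one_right (by linarith) (pow_le_one₀ (by norm_num) (by norm_num))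
    linarith [hTu k, hB' k]
  set D : Finset ℕ → (ℕ → 𝕜) → ℝ := fun s a =>
    ‖∑ k ∈ s, a k • B'.block (m k) (m (k + 1)) (T (u k))‖ with hD
  have hcoef : ∀ s a, ∀ k ∈ s, ‖a k‖ * (δ / 2) ≤ D s a := by
    intro s a k hk
    have h1 := le_lpSum hp hk (fun k => ‖a k‖₊ * ‖B'.block (m k) (m (k + 1)) (T (u k))‖₊)
    rw [← B'.nnnorm_sum_block hp hm, ← NNReal.coe_le_coe] at h1
    refine le_trans ?_ h1
    push_cast
    gcongr
    exact hd k
  have hlow : ∀ s a, D s a ≤ 2 * ‖T (∑ k ∈ s, a k • u k)‖ := by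
    intro s a
    have h1 := norm_sum_smul_sub_le hB' (norm_nonneg _) (hcoef s a)
    rw [← norm_neg, neg_sub] at h1
    have h2 := (norm_sub_norm_le _ _).trans h1
    simp only [map_sum, map_smul]
    simp only [hD] at h2 ⊢
    linarith
  have hup : ∀ s a, ‖∑ k ∈ s, a k • u k‖ ≤ (4 / δ + 1 / 2) * D s a := by
    intro s a
    have h1 := (norm_sub_norm_le _ _).trans (norm_sum_smul_sub_le hB (norm_nonneg _) (hcoef s a))
    have h2 := lpSum_mono hp (s := s)
      (t := fun k => ‖a k‖₊ * ‖B.block (m k) (m (k + 1)) (u k)‖₊)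
      (t' := fun k => (4 / δ).toNNReal * (‖a k‖₊ * ‖B'.block (m k) (m (k + 1)) (T (u k))‖₊))
      fun k _ => by
        rw [← NNReal.coe_le_coe]
        push_cast [Real.coe_toNNReal (4 / δ) (by positivity)]
        rw [mul_left_comm]
        have h3 : 2 ≤ 4 / δ * ‖B'.block (m k) (m (k + 1)) (T (u k))‖ := by
          rw [div_mul_eq_mul_div, le_div_iff₀ hδ]
          linarith [hd k]
        exact mul_le_mul_of_nonneg_left (((B.norm_block_le hp _ _ _).trans (hu2 k)).trans h3)
          (norm_nonneg _)
    rw [lpSum_mul hp, ← B.nnnorm_sum_block hp hm, ← B'.nnnorm_sum_block hp hm,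
      ← NNReal.coe_le_coe] at h2
    push_cast [Real.coe_toNNReal (4 / δ) (by positivity)] at h2
    linarith
  have hli : LinearIndependent 𝕜 u := by
    rw [linearIndependent_iff']
    intro s a h0 k hk
    have h1 := (hcoef s a k hk).trans (hlow s a)
    rw [h0, map_zero, norm_zero, mul_zero] at h1
    have h2 : ‖a k‖ ≤ 0 := nonpos_of_mul_nonpos_left h1 (half_pos hδ)
    simpa using h2
  have hK : 0 < 2 * (4 / δ + 1 / 2) := by positivity
  refine hT.not_bounded_below (Submodule.span 𝕜 (Set.range u)) (fun hfin => ?_) (inv_pos.2 hK) ?_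
  · exact not_finite_iff_infinite.2 inferInstance (linearIndependent_span hli).finite
  · intro x hx
    obtain ⟨c, rfl⟩ := (Finsupp.mem_span_range_iff_exists_finsupp).1 hx
    rw [inv_mul_le_iff₀ hK]
    have h1 := hup c.support c
    have h2 := mul_le_mul_of_nonneg_left (hlow c.support c)
      (show 0 ≤ 4 / δ + 1 / 2 by positivity)
    rw [Finsupp.sum]
    linarith

end LpBasis

end Growth

section DirectSum

/-- A presentation of `X` as the direct sum of `ℓ^{p_1}, …, ℓ^{p_{n+1}}`. -/
structure LpDirectSum (𝕜 : Type*) [RCLike 𝕜] {n : ℕ} (p : Fin (n + 1) → ℝ≥0∞)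
    (E : Fin (n + 1) → Type*) [∀ i, NormedAddCommGroup (E i)] [∀ i, NormedSpace 𝕜 (E i)]
    (X : Type*) [NormedAddCommGroup X] [NormedSpace 𝕜 X] where
  basis : ∀ i, LpBasis 𝕜 (p i) (E i)
  ι : ∀ i, E i →L[𝕜] X
  π : ∀ i, X →L[𝕜] E i
  π_ι : ∀ i x, π i (ι i x) = x
  π_ι_ne : ∀ i j, i ≠ j → ∀ x, π j (ι i x) = 0
  sum_ι_π : ∀ x, ∑ i, ι i (π i x) = x

namespace LpDirectSum

variable {𝕜 : Type*} [RCLike 𝕜] {n : ℕ} {p : Fin (n + 1) → ℝ≥0∞}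
  {E : Fin (n + 1) → Type*} [∀ i, NormedAddCommGroup (E i)] [∀ i, NormedSpace 𝕜 (E i)]
  {X : Type*} [NormedAddCommGroup X] [NormedSpace 𝕜 X] (D : LpDirectSum 𝕜 p E X)

/-- The matrix entries of an operator. -/
def entry (i j : Fin (n + 1)) (T : X →L[𝕜] X) : E i →L[𝕜] E j := (D.π j).comp (T.comp (D.ι i))

theorem entry_apply (i j : Fin (n + 1)) (T : X →L[𝕜] X) (x : E i) :
    D.entry i j T x = D.π j (T (D.ι i x)) := rfl

theorem π_apply (T : X →L[𝕜] X) (j : Fin (n + 1)) (x : X) :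
    D.π j (T x) = ∑ i, D.entry i j T (D.π i x) := by
  conv_lhs => rw [← D.sum_ι_π x]
  simp [entry_apply]

theorem ext_e {S T : X →L[𝕜] X}
    (h : ∀ i k, S (D.ι i ((D.basis i).e k)) = T (D.ι i ((D.basis i).e k))) : S = T := by
  ext x
  rw [← D.sum_ι_π x, map_sum, map_sum]
  refine Finset.sum_congr rfl fun i _ => ?_
  have : S.comp (D.ι i) = T.comp (D.ι i) := (D.basis i).ext_e fun k => h i k
  exact DFunLike.congr_fun this _

theorem isCompactOperator_sum {F G : Type*} [NormedAddCommGroup F] [NormedSpace 𝕜 F]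
    [NormedAddCommGroup G] [NormedSpace 𝕜 G] {κ : Type*} (s : Finset κ) {T : κ → F →L[𝕜] G}
    (h : ∀ k ∈ s, IsCompactOperator (T k)) :
    IsCompactOperator ((∑ k ∈ s, T k : F →L[𝕜] G) : F → G) :=
  Submodule.sum_mem (compactOperator (RingHom.id 𝕜) F G) h

/-- The operators whose matrix is compact below the `k`-th diagonal. -/
def filtration (k : ℕ) : Submodule 𝕜 (X →L[𝕜] X) where
  carrier := {T | ∀ i j : Fin (n + 1), (j : ℕ) < i + k → IsCompactOperator (D.entry i j T)}
  add_mem' {S T} hS hT i j hij := by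
    have : D.entry i j (S + T) = D.entry i j S + D.entry i j T := by
      ext x; simp [entry_apply]
    rw [this]
    exact (hS i j hij).add (hT i j hij)
  zero_mem' i j _ := by
    have : D.entry i j 0 = 0 := by
      ext x; simp [entry_apply]
    rw [this]
    exact isCompactOperator_zero
  smul_mem' c T hT i j hij := by
    have : D.entry i j (c • T) = c • D.entry i j T := by
      ext x; simp [entry_apply]
    rw [this]
    exact (hT i j hij).smul c

theorem mem_filtration {k : ℕ} {T : X →L[𝕜] X} : T ∈ D.filtration k ↔
    ∀ i j : Fin (n + 1), (j : ℕ) < i + k → IsCompactOperator (D.entry i j T) := Iff.rfl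

theorem filtration_anti {k l : ℕ} (h : k ≤ l) : D.filtration l ≤ D.filtration k :=
  fun _ hT i j hij => hT i j (by omega)

theorem mul_mem_filtration {k l : ℕ} {S T : X →L[𝕜] X} (hS : S ∈ D.filtration k)
    (hT : T ∈ D.filtration l) : S * T ∈ D.filtration (k + l) := by
  intro i j hij
  have : D.entry i j (S * T) = ∑ m, (D.entry m j S).comp (D.entry i m T) := by
    ext x
    simp only [entry_apply, mul_apply_eq_comp, sum_apply,
      ContinuousLinearMap.comp_apply]
    rw [D.π_apply]
    rfl
  rw [this]
  refine isCompactOperator_sum _ fun m _ => ?_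
  by_cases h : (j : ℕ) < m + k
  · exact (hS m j h).comp_clm (D.entry i m T)
  · exact (hT i m (by omega)).clm_comp (D.entry m j S)

theorem isClosed_filtration [∀ i, CompleteSpace (E i)] (k : ℕ) :
    IsClosed (D.filtration k : Set (X →L[𝕜] X)) := by
  have : (D.filtration k : Set (X →L[𝕜] X)) = ⋂ (i : Fin (n + 1)) (j : Fin (n + 1))
      (_ : (j : ℕ) < i + k), D.entry i j ⁻¹' {T | IsCompactOperator T} := by
    ext T
    simp [mem_filtration]
  rw [this]
  refine isClosed_iInter fun i => isClosed_iInter fun j => isClosed_iInter fun _ => ?_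
  refine isClosed_setOfPred_isCompactOperator.preimage ?_
  exact continuous_const.clm_comp (continuous_id.clm_comp continuous_const)

theorem mem_filtration_iff_isCompactOperator {T : X →L[𝕜] X} :
    T ∈ D.filtration (n + 1) ↔ IsCompactOperator T := by
  constructor
  · intro hT
    have : T = ∑ i, ∑ j, (D.ι j).comp ((D.entry i j T).comp (D.π i)) := by
      ext x
      simp only [sum_apply, ContinuousLinearMap.comp_apply]
      rw [Finset.sum_comm]
      simp_rw [← map_sum, ← D.π_apply, D.sum_ι_π]
    rw [this]
    refine isCompactOperator_sum _ fun i _ => isCompactOperator_sum _ fun j _ => ?_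
    exact ((hT i j (by omega)).comp_clm (D.π i)).clm_comp (D.ι j)
  · intro hT i j _
    exact (hT.comp_clm (D.ι i)).clm_comp (D.π j)

theorem filtration_zero [∀ i, CompleteSpace (E i)] (hp : ∀ i, 1 ≤ p i) (hmono : StrictMono p) :
    D.filtration 0 = ⊤ := by
  refine eq_top_iff.2 fun T _ i j hij => ?_
  exact (D.basis i).isCompactOperator_of_lt (D.basis j) (hp j) (hmono (by simpa using hij)) _

theorem isStrictlySingular_entry {T : X →L[𝕜] X} (hT : IsStrictlySingular T)
    (i j : Fin (n + 1)) : IsStrictlySingular (D.entry i j T) := by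
  rintro M - hM ⟨c, hc, h⟩
  have hinj : Function.Injective (D.ι i) := fun x y h => by
    rw [← D.π_ι i x, h, D.π_ι]
  have hK : 0 < (‖D.π j‖ + 1) * (‖D.ι i‖ + 1) := by positivity
  refine hT.not_bounded_below (M.map (D.ι i).toLinearMap) (fun hfin => hM ?_)
    (c := c / ((‖D.π j‖ + 1) * (‖D.ι i‖ + 1))) (by positivity) ?_
  · exact Module.Finite.equiv (Submodule.equivMapOfInjective (D.ι i).toLinearMap hinj M).symm
  · rintro _ ⟨x, hx, rfl⟩
    have h1 := h x hx
    rw [div_mul_eq_mul_div, div_le_iff₀ hK]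
    have h2 : ‖D.entry i j T x‖ ≤ (‖D.π j‖ + 1) * ‖T (D.ι i x)‖ := by
      refine ((D.π j).le_opNorm _).trans ?_
      gcongr
      · simp
      · rfl
    have h3 : ‖D.ι i x‖ ≤ (‖D.ι i‖ + 1) * ‖x‖ := by
      refine ((D.ι i).le_opNorm _).trans ?_
      gcongr
      simp
    simp only [ContinuousLinearMap.coe_coe]
    calc c * ‖D.ι i x‖ ≤ c * ((‖D.ι i‖ + 1) * ‖x‖) := by gcongr
      _ = (‖D.ι i‖ + 1) * (c * ‖x‖) := by ring
      _ ≤ (‖D.ι i‖ + 1) * ((‖D.π j‖ + 1) * ‖T (D.ι i x)‖) := 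
          mul_le_mul_of_nonneg_left (h1.trans h2) (by positivity)
      _ = _ := by ring

theorem mem_filtration_one_of_isStrictlySingular [∀ i, CompleteSpace (E i)] (hp : ∀ i, 1 ≤ p i)
    (hmono : StrictMono p) {T : X →L[𝕜] X} (hT : IsStrictlySingular T) :
    T ∈ D.filtration 1 := by
  intro i j hij
  rcases (Nat.lt_succ_iff.1 hij).lt_or_eq with h | h
  · exact D.filtration_zero hp hmono ▸ Submodule.mem_top (x := T) |>
      fun h0 : T ∈ D.filtration 0 => h0 i j h
  · obtain rfl : j = i := Fin.ext h
    exact (D.basis j).isCompactOperator_of_isStrictlySingular (D.basis j) (hp j)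
      (D.isStrictlySingular_entry hT j j)

/-- The projection onto the span of the first `N` basis vectors of each summand. -/
def trunc (N : ℕ) : X →L[𝕜] X := ∑ i, (D.ι i).comp (((D.basis i).block 0 N).comp (D.π i))

theorem trunc_apply (N : ℕ) (x : X) :
    D.trunc N x = ∑ i, D.ι i ((D.basis i).block 0 N (D.π i x)) := by
  simp [trunc]

theorem π_trunc (N : ℕ) (i : Fin (n + 1)) (x : X) :
    D.π i (D.trunc N x) = (D.basis i).block 0 N (D.π i x) := by
  rw [trunc_apply, map_sum, Finset.sum_eq_single i]
  · exact D.π_ι _ _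
  · intro j _ hj
    exact D.π_ι_ne _ _ hj _
  · simp

theorem isCompactOperator_trunc (N : ℕ) : IsCompactOperator (D.trunc N) :=
  isCompactOperator_sum _ fun i _ =>
    (((D.basis i).isCompactOperator_block 0 N).comp_clm (D.π i)).clm_comp (D.ι i)

theorem tendsto_trunc (x : X) : Tendsto (fun N => D.trunc N x) atTop (𝓝 x) := by
  simp_rw [trunc_apply]
  conv => arg 3; rw [← D.sum_ι_π x]
  exact tendsto_finsetSum _ fun i _ =>
    ((D.ι i).continuous.tendsto _).comp ((D.basis i).tendsto_block _)

theorem norm_trunc_le (hp : ∀ i, 1 ≤ p i) (N : ℕ) (x : X) :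
    ‖D.trunc N x‖ ≤ (∑ i, ‖D.ι i‖ * ‖D.π i‖) * ‖x‖ := by
  rw [trunc_apply, Finset.sum_mul]
  refine (norm_sum_le _ _).trans (Finset.sum_le_sum fun i _ => ?_)
  calc _ ≤ ‖D.ι i‖ * ‖(D.basis i).block 0 N (D.π i x)‖ := (D.ι i).le_opNorm _
    _ ≤ ‖D.ι i‖ * (‖D.π i‖ * ‖x‖) := by
      gcongr
      exact ((D.basis i).norm_block_le (hp i) _ _ _).trans ((D.π i).le_opNorm _)
    _ = _ := by ring

end LpDirectSum

end DirectSum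

section DirectSumIdeal

namespace LpDirectSum

variable {𝕜 : Type*} [RCLike 𝕜] {n : ℕ} {p : Fin (n + 1) → ℝ≥0∞}
  {E : Fin (n + 1) → Type*} [∀ i, NormedAddCommGroup (E i)] [∀ i, NormedSpace 𝕜 (E i)]
  {X : Type*} [NormedAddCommGroup X] [NormedSpace 𝕜 X] (D : LpDirectSum 𝕜 p E X)

theorem exists_compact_part {T : X →L[𝕜] X} (hT : T ∈ D.filtration 1) :
    ∃ C : X →L[𝕜] X, IsCompactOperator C ∧ ∀ j x, D.π j (T x) =
      D.π j (C x) + ∑ i with i < j, D.entry i j T (D.π i x) := by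
  classical
  refine ⟨∑ i, ∑ j, if j ≤ i then (D.ι j).comp ((D.entry i j T).comp (D.π i)) else 0,
    isCompactOperator_sum _ fun i _ => isCompactOperator_sum _ fun j _ => ?_, fun j x => ?_⟩
  · split_ifs with h
    · exact ((hT i j (Nat.lt_succ_of_le h)).comp_clm (D.π i)).clm_comp (D.ι j)
    · exact isCompactOperator_zero
  · have h1 : ∀ i, D.π j ((∑ l, if l ≤ i then (D.ι l).comp ((D.entry i l T).comp (D.π i)) else 0 :
        X →L[𝕜] X) x) = if j ≤ i then D.entry i j T (D.π i x) else 0 := by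
      intro i
      rw [sum_apply, map_sum, Finset.sum_eq_single j]
      · split_ifs
        · exact D.π_ι _ _
        · simp
      · intro l _ hl
        split_ifs
        · exact D.π_ι_ne _ _ hl _
        · simp
      · simp
    rw [sum_apply, map_sum, D.π_apply, Finset.sum_congr rfl fun i _ => h1 i, Finset.sum_filter,
      ← Finset.sum_add_distrib]
    refine Finset.sum_congr rfl fun i _ => ?_
    by_cases h : j ≤ i
    · simp [h, not_lt.2 h]
    · simp [h, not_le.1 h]

theorem norm_le_sum_norm_π (x : X) : ‖x‖ ≤ ∑ j, ‖D.ι j‖ * ‖D.π j x‖ := by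
  conv_lhs => rw [← D.sum_ι_π x]
  exact norm_sum_le_of_le _ fun j _ => (D.ι j).le_opNorm _

section Blocks

variable {T C : X →L[𝕜] X} {u : ℕ → X} {m : ℕ → ℕ} {r A : ℝ}

/-- Upper estimate for `T` on sums of a sequence of near blocks with small first coordinates. -/
theorem exists_norm_π_sum_le (hp : ∀ i, 1 ≤ p i) (hmono : StrictMono p)
    (hTC : ∀ j x, D.π j (T x) = D.π j (C x) + ∑ i with i < j, D.entry i j T (D.π i x))
    (hm : StrictMono m) (hr : ∀ k, ‖u k‖ ≤ r)
    (hTu : ∀ i k, ‖D.π i (T (u k)) - (D.basis i).block (m k) (m (k + 1)) (D.π i (T (u k)))‖ ≤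
      A * (1 / 2) ^ k) (hA : 0 ≤ A)
    (hC : ∀ k, ‖C (u k)‖ ≤ (1 / 2) ^ k) {i l : Fin (n + 1)} (hl : ∀ j, i < j → l ≤ j)
    (j : Fin (n + 1)) :
    ∃ K : ℝ, ∀ s : Finset ℕ, s.Nonempty →
      (∀ i' < i, ∀ k ∈ s, ‖D.π i' (u k)‖ ≤ (s.card : ℝ)⁻¹) →
      ‖D.π j (T (∑ k ∈ s, u k))‖ ≤ K * (s.card : ℝ) ^ (p l).toReal⁻¹ := by
  have hr0 : 0 ≤ r := (norm_nonneg _).trans (hr 0)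
  have hone : ∀ s : Finset ℕ, s.Nonempty → (1 : ℝ) ≤ s.card := fun s hs => by
    exact_mod_cast hs.card_pos
  have hpow : ∀ s : Finset ℕ, s.Nonempty → (1 : ℝ) ≤ (s.card : ℝ) ^ (p l).toReal⁻¹ :=
    fun s hs => Real.one_le_rpow (hone s hs) (inv_nonneg.2 ENNReal.toReal_nonneg)
  rcases lt_or_ge i j with hij | hji
  · refine ⟨‖D.π j‖ * (‖T‖ * r) + A * 2, fun s hs _ => ?_⟩
    have h1 := (D.basis j).norm_sum_le_of_near_blocks (hp j) hm (hTu j) hs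
      (η := A * 2) (r := ‖D.π j‖ * (‖T‖ * r))
      (by rw [← Finset.mul_sum]; exact mul_le_mul_of_nonneg_left (sum_half_pow_le s) hA)
      (by positivity) fun k _ => ((D.π j).le_opNorm _).trans
        (mul_le_mul_of_nonneg_left (T.le_opNorm_of_le (hr k)) (norm_nonneg _))
    have h2 : (s.card : ℝ) ^ (p j).toReal⁻¹ ≤ (s.card : ℝ) ^ (p l).toReal⁻¹ := by
      refine Real.rpow_le_rpow_of_exponent_le (hone s hs) ?_
      rcases (hl j hij).eq_or_lt with h | h
      · rw [h]
      · exact (inv_toReal_lt (hp l) (hmono h)).le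
    rw [map_sum, map_sum]
    refine h1.trans ?_
    rw [add_mul]
    exact add_le_add (mul_le_mul_of_nonneg_left h2 (by positivity))
      (le_mul_of_one_le_right (by positivity) (hpow s hs))
  · refine ⟨‖D.π j‖ * 2 + ∑ i' with i' < j, ‖D.entry i' j T‖ * 1, fun s hs h => ?_⟩
    refine le_trans ?_ (le_mul_of_one_le_right (by positivity) (hpow s hs))
    rw [hTC]
    refine (norm_add_le _ _).trans (add_le_add ?_ (norm_sum_le_of_le _ fun i' hi' => ?_))
    · refine (D.π j).le_opNorm_of_le ?_
      rw [map_sum]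
      exact (norm_sum_le_of_le _ fun k _ => hC k).trans (sum_half_pow_le s)
    · refine (D.entry i' j T).le_opNorm_of_le ?_
      rw [map_sum]
      refine (norm_sum_le_of_le _ fun k hk =>
        h i' ((Finset.mem_filter.1 hi').2.trans_le hji) k hk).trans ?_
      rw [Finset.sum_const, nsmul_eq_mul, mul_inv_cancel₀]
      exact (zero_lt_one.trans_le (hone s hs)).ne'

theorem tendsto_π_zero (hp : ∀ i, 1 ≤ p i) (hmono : StrictMono p)
    (hTC : ∀ j x, D.π j (T x) = D.π j (C x) + ∑ i with i < j, D.entry i j T (D.π i x))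
    (hm : StrictMono m) (hr : ∀ k, ‖u k‖ ≤ r)
    (hu : ∀ i k, ‖D.π i (u k) - (D.basis i).block (m k) (m (k + 1)) (D.π i (u k))‖ ≤
      A * (1 / 2) ^ k)
    (hTu : ∀ i k, ‖D.π i (T (u k)) - (D.basis i).block (m k) (m (k + 1)) (D.π i (T (u k)))‖ ≤
      A * (1 / 2) ^ k) (hA : 0 ≤ A)
    (hC : ∀ k, ‖C (u k)‖ ≤ (1 / 2) ^ k) {c : ℝ} (hc : 0 < c)
    (hlow : ∀ s : Finset ℕ, c * ‖∑ k ∈ s, u k‖ ≤ ‖T (∑ k ∈ s, u k)‖)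
    (i : Fin (n + 1)) (hi : i < Fin.last n) : Tendsto (fun k => D.π i (u k)) atTop (𝓝 0) := by
  induction i using WellFoundedLT.induction with
  | ind i ih =>
  by_contra hnot
  obtain ⟨δ, hδ, hfreq⟩ : ∃ δ > 0, ∃ᶠ k in atTop, δ ≤ ‖D.π i (u k)‖ := by
    rw [Metric.tendsto_nhds] at hnot
    push Not at hnot
    simpa [not_eventually] using hnot
  have hi' : (i : ℕ) + 1 < n + 1 := by
    have := Fin.lt_def.1 hi
    simpa using this
  set l : Fin (n + 1) := ⟨i + 1, hi'⟩ with hl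
  choose K hK using D.exists_norm_π_sum_le hp hmono hTC hm hr hTu hA hC (i := i) (l := l)
    (fun j hj => Fin.le_def.2 (Nat.succ_le_of_lt (Fin.lt_def.1 hj)))
  refine not_forall_rpow_le (inv_nonneg.2 ENNReal.toReal_nonneg)
    (inv_toReal_lt (hp i) (hmono (show i < l from Fin.lt_def.2 (Nat.lt_succ_self _))))
    (mul_pos hc (half_pos hδ)) (‖D.π i‖ * ∑ j, ‖D.ι j‖ * K j) (c * (A * 2)) fun N hN => ?_
  have hN0 : (0 : ℝ) < N := by exact_mod_cast hN
  have hev : ∀ᶠ k in atTop, A * (1 / 2 : ℝ) ^ k ≤ δ / 2 := by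
    have := (tendsto_pow_atTop_nhds_zero_of_lt_one (r := (1 / 2 : ℝ)) (by norm_num)
      (by norm_num)).const_mul A
    rw [mul_zero] at this
    exact this.eventually (ge_mem_nhds (half_pos hδ))
  have hev' : ∀ᶠ k in atTop, ∀ i' < i, ‖D.π i' (u k)‖ ≤ (N : ℝ)⁻¹ := by
    rw [eventually_all]
    intro i'
    by_cases h : i' < i
    · have h1 := (ih i' h (h.trans hi)).norm.eventually
        (ge_mem_nhds (show ‖(0 : E i')‖ < (N : ℝ)⁻¹ by simpa using hN0))
      filter_upwards [h1] with k hk _ using hk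
    · exact Eventually.of_forall fun k h' => absurd h' h
  obtain ⟨s, hs, hcard⟩ := (Nat.frequently_atTop_iff_infinite.1
    ((hfreq.and_eventually hev).and_eventually hev')).exists_subset_card_eq N
  have hne : s.Nonempty := Finset.card_pos.1 (by omega)
  have h1 := (D.basis i).le_norm_sum_of_near_blocks (hp i) hm (hu i) hne (η := A * 2)
    (by rw [← Finset.mul_sum]; exact mul_le_mul_of_nonneg_left (sum_half_pow_le s) hA) hδ.le
    (fun k hk => (hs hk).1.1) (fun k hk => (hs hk).1.2)
  rw [← map_sum, hcard] at h1
  have h2 := (D.norm_le_sum_norm_π (T (∑ k ∈ s, u k))).trans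
    (Finset.sum_le_sum fun j _ => mul_le_mul_of_nonneg_left
      (hK j s hne fun i' h' k hk => by rw [hcard]; exact (hs hk).2 i' h') (norm_nonneg _))
  rw [hcard] at h2
  have h3 := (D.π i).le_opNorm (∑ k ∈ s, u k)
  have h4 := mul_le_mul_of_nonneg_left ((hlow s).trans h2) (norm_nonneg (D.π i))
  have h5 := mul_le_mul_of_nonneg_left h3 hc.le
  have h6 := mul_le_mul_of_nonneg_left h1 hc.le
  have h7 : ∑ j, ‖D.ι j‖ * (K j * (N : ℝ) ^ (p l).toReal⁻¹) =
      (∑ j, ‖D.ι j‖ * K j) * (N : ℝ) ^ (p l).toReal⁻¹ := by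
    rw [Finset.sum_mul]
    exact Finset.sum_congr rfl fun j _ => by ring
  rw [h7] at h4
  linarith

end Blocks

theorem isStrictlySingular_of_mem_filtration_one (hp : ∀ i, 1 ≤ p i) (hmono : StrictMono p)
    {T : X →L[𝕜] X} (hT : T ∈ D.filtration 1) : IsStrictlySingular T := by
  rintro M - hM ⟨c, hc, hlow⟩
  obtain ⟨R, f, -, hf, hsep⟩ := exists_seq_norm_le_one_le_norm_sub hM
  obtain ⟨C, hC, hTC⟩ := D.exists_compact_part hT
  obtain ⟨u, m, hm, hu, hnear⟩ := exists_block_differences D.trunc D.isCompactOperator_trunc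
    D.tendsto_trunc D.trunc D.isCompactOperator_trunc D.tendsto_trunc T C hC
    (x := fun k => (f k : X)) (r := R) hf (ε := fun k => (1 / 2) ^ k) fun k => by positivity
  have huM : ∀ k, u k ∈ M := fun k => by
    obtain ⟨a, b, -, h⟩ := hu k
    exact h ▸ M.sub_mem (f b).2 (f a).2
  have hu1 : ∀ k, 1 ≤ ‖u k‖ := fun k => by
    obtain ⟨a, b, hab, h⟩ := hu k
    exact h ▸ hsep hab.symm
  have hr : ∀ k, ‖u k‖ ≤ R + R := fun k => by
    obtain ⟨a, b, -, h⟩ := hu k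
    exact h ▸ (norm_sub_le _ _).trans (add_le_add (hf b) (hf a))
  have hblock : ∀ i k (y : X), ‖y - (D.trunc (m (k + 1)) - D.trunc (m k)) y‖ ≤ (1 / 2) ^ k →
      ‖D.π i y - (D.basis i).block (m k) (m (k + 1)) (D.π i y)‖ ≤
        (∑ i, ‖D.π i‖) * (1 / 2) ^ k := by
    intro i k y h
    rw [← (D.basis i).block_sub_block (hm (Nat.lt_succ_self k)).le, sub_apply, ← D.π_trunc,
      ← D.π_trunc, ← map_sub, ← map_sub]
    refine (D.π i).le_of_opNorm_le_of_le
      (Finset.single_le_sum (f := fun i => ‖D.π i‖) (fun _ _ => norm_nonneg _)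
        (Finset.mem_univ i)) ?_
    simpa using h
  have hlim := D.tendsto_π_zero hp hmono hTC hm hr (fun i k => hblock i k _ (hnear k).1)
    (fun i k => hblock i k _ (hnear k).2.1) (by positivity) (fun k => (hnear k).2.2) hc
    (fun s => hlow _ (M.sum_mem fun k _ => huM k))
  have hC0 : Tendsto (fun k => C (u k)) atTop (𝓝 0) :=
    squeeze_zero_norm (fun k => (hnear k).2.2)
      (tendsto_pow_atTop_nhds_zero_of_lt_one (by norm_num) (by norm_num))
  have hπT : ∀ j, Tendsto (fun k => D.π j (T (u k))) atTop (𝓝 0) := by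
    intro j
    simp_rw [hTC]
    have h1 := ((D.π j).continuous.tendsto 0).comp hC0
    have h2 : Tendsto (fun k => ∑ i with i < j, D.entry i j T (D.π i (u k))) atTop
        (𝓝 (∑ i with i < j, D.entry i j T 0)) :=
      tendsto_finsetSum _ fun i hi => ((D.entry i j T).continuous.tendsto 0).comp
        (hlim i ((Finset.mem_filter.1 hi).2.trans_le (Fin.le_last j)))
    simpa using h1.add h2
  have hT0 : Tendsto (fun k => T (u k)) atTop (𝓝 0) := by
    have h : Tendsto (fun k => ∑ j, D.ι j (D.π j (T (u k)))) atTop (𝓝 (∑ j, D.ι j 0)) :=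
      tendsto_finsetSum _ fun j _ => ((D.ι j).continuous.tendsto 0).comp (hπT j)
    simpa only [D.sum_ι_π, map_zero, Finset.sum_const_zero] using h
  have h0 : c ≤ ‖(0 : X)‖ := ge_of_tendsto' hT0.norm fun k =>
    (le_mul_of_one_le_right hc.le (hu1 k)).trans (hlow _ (huM k))
  rw [norm_zero] at h0
  exact absurd hc (not_lt.2 h0)

theorem isStrictlySingular_iff [∀ i, CompleteSpace (E i)] (hp : ∀ i, 1 ≤ p i)
    (hmono : StrictMono p) {T : X →L[𝕜] X} : IsStrictlySingular T ↔ T ∈ D.filtration 1 :=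
  ⟨D.mem_filtration_one_of_isStrictlySingular hp hmono,
    D.isStrictlySingular_of_mem_filtration_one hp hmono⟩

end LpDirectSum

end DirectSumIdeal

section Subideals

theorem LpBasis.norm_coord_le {𝕜 E : Type*} [RCLike 𝕜] {p : ℝ≥0∞} [NormedAddCommGroup E]
    [NormedSpace 𝕜 E] (B : LpBasis 𝕜 p E) (hp : 1 ≤ p) (k : ℕ) (x : E) :
    ‖B.coord k x‖ ≤ ‖x‖ := by
  simpa [B.block_apply, norm_smul, B.norm_e hp] using B.norm_block_le hp k (k + 1) x

namespace LpDirectSum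

variable {𝕜 : Type*} [RCLike 𝕜] {n : ℕ} {p : Fin (n + 1) → ℝ≥0∞}
  {E : Fin (n + 1) → Type*} [∀ i, NormedAddCommGroup (E i)] [∀ i, NormedSpace 𝕜 (E i)]
  {X : Type*} [NormedAddCommGroup X] [NormedSpace 𝕜 X] (D : LpDirectSum 𝕜 p E X)

theorem isStrictlySingular_of_isCompactOperator (D : LpDirectSum 𝕜 p E X)
    (hp : ∀ i, 1 ≤ p i) (hmono : StrictMono p) {T : X →L[𝕜] X} (hT : IsCompactOperator T) : IsStrictlySingular T :=
  D.isStrictlySingular_of_mem_filtration_one hp hmono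
    (D.filtration_anti (Nat.le_add_left 1 n) (D.mem_filtration_iff_isCompactOperator.2 hT))

theorem prodsOf_subset_filtration [∀ i, CompleteSpace (E i)] (hp : ∀ i, 1 ≤ p i)
    (hmono : StrictMono p) (k : ℕ) :
    prodsOf {U : X →L[𝕜] X | IsStrictlySingular U} k ⊆ D.filtration (k + 1) := by
  induction k with
  | zero => exact fun T hT => (D.isStrictlySingular_iff hp hmono).1 hT
  | succ k ih =>
    rintro _ ⟨y, hy, s, hs, rfl⟩
    exact D.mul_mem_filtration (ih hy) ((D.isStrictlySingular_iff hp hmono).1 hs)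

theorem smulRight_mem_prodsOf (D : LpDirectSum 𝕜 p E X) (hp : ∀ i, 1 ≤ p i)
    (hmono : StrictMono p) (k : ℕ) (f : X →L[𝕜] 𝕜) (x : X) :
    f.smulRight x ∈ prodsOf {U : X →L[𝕜] X | IsStrictlySingular U} k := by
  have h : ∀ (f : X →L[𝕜] 𝕜) x, IsStrictlySingular (f.smulRight x) := fun f x =>
    D.isStrictlySingular_of_isCompactOperator hp hmono
      ((isCompactOperator_of_locallyCompactSpace_dom f).clm_comp
        (ContinuousLinearMap.toSpanSingleton 𝕜 x))
  induction k generalizing f x with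
  | zero => exact h f x
  | succ k ih =>
    refine ⟨((D.basis 0).coord 0 ∘L D.π 0).smulRight x, ih _ _,
      f.smulRight (D.ι 0 ((D.basis 0).e 0)), h _ _, ?_⟩
    ext z
    simp [D.π_ι, (D.basis 0).coord_e]

theorem trunc_mul_mem_span (hp : ∀ i, 1 ≤ p i) (hmono : StrictMono p) (k N : ℕ)
    (T : X →L[𝕜] X) : D.trunc N * T ∈
      Submodule.span 𝕜 (prodsOf {U : X →L[𝕜] X | IsStrictlySingular U} k) := by
  have : D.trunc N * T = ∑ i, ∑ l ∈ Finset.Ico 0 N,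
      ((D.basis i).coord l ∘L D.π i ∘L T).smulRight (D.ι i ((D.basis i).e l)) := by
    ext x
    simp [trunc_apply, LpBasis.block_apply]
  rw [this]
  exact Submodule.sum_mem _ fun i _ => Submodule.sum_mem _ fun l _ =>
    Submodule.subset_span (D.smulRight_mem_prodsOf hp hmono k _ _)

theorem tendsto_trunc_mul (hp : ∀ i, 1 ≤ p i) {T : X →L[𝕜] X} (hT : IsCompactOperator T) :
    Tendsto (fun N => D.trunc N * T) atTop (𝓝 T) := by
  set A := ∑ i, ‖D.ι i‖ * ‖D.π i‖ with hA
  have hA0 : 0 ≤ A := by positivity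
  rw [Metric.tendsto_nhds]
  intro ε hε
  have hη : 0 < ε / 2 / (A + 2) := by positivity
  obtain ⟨t, ht, hcov⟩ := Metric.totallyBounded_iff.1
    (IsCompactOperator.isCompact_closure_image_closedBall (f := T.toLinearMap) hT 1).totallyBounded
    _ hη
  have hev : ∀ᶠ N in atTop, ∀ y ∈ t, ‖D.trunc N y - y‖ < ε / 2 / (A + 2) := by
    rw [ht.eventually_all]
    intro y _
    simpa [dist_eq_norm] using Metric.tendsto_nhds.1 (D.tendsto_trunc y) _ hη
  filter_upwards [hev] with N hN
  rw [dist_eq_norm]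
  refine (ContinuousLinearMap.opNorm_le_of_unit_norm (half_pos hε).le fun x hx => ?_).trans_lt
    (half_lt_self hε)
  obtain ⟨y, hy, hxy⟩ := Set.mem_iUnion₂.1 (hcov (subset_closure
    ⟨x, by simpa using hx.le, rfl⟩))
  have h1 : ‖T x - y‖ < ε / 2 / (A + 2) := by simpa [dist_eq_norm] using hxy
  have h2 := D.norm_trunc_le hp N (T x - y)
  have h3 := mul_le_mul_of_nonneg_left h1.le hA0
  have h4 : (D.trunc N * T - T) x = D.trunc N (T x - y) + (D.trunc N y - y) - (T x - y) := by
    simp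
  have h5 : (A + 2) * (ε / 2 / (A + 2)) = ε / 2 := mul_div_cancel₀ _ (by positivity)
  rw [h4]
  refine (norm_sub_le _ _).trans ((add_le_add_left (norm_add_le _ _) _).trans ?_)
  linarith [hN y hy]

theorem closure_span_prodsOf [∀ i, CompleteSpace (E i)] (D : LpDirectSum 𝕜 p E X)
    (hp : ∀ i, 1 ≤ p i) (hmono : StrictMono p) :
    closure (Submodule.span 𝕜 (prodsOf {U : X →L[𝕜] X | IsStrictlySingular U} n) :
      Set (X →L[𝕜] X)) = {T : X →L[𝕜] X | IsCompactOperator T} := by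
  refine subset_antisymm (fun T hT => D.mem_filtration_iff_isCompactOperator.1 ?_) fun T hT => ?_
  · exact closure_minimal (Submodule.span_le.2 (D.prodsOf_subset_filtration hp hmono n))
      (D.isClosed_filtration (n + 1)) hT
  · exact mem_closure_of_tendsto (D.tendsto_trunc_mul hp hT)
      (Eventually.of_forall fun N => D.trunc_mul_mem_span hp hmono n N T)

/-- The shift operator mapping each summand formally identically into the next one. -/
theorem exists_shift [∀ i, CompleteSpace (E i)] (hp : ∀ i, 1 ≤ p i) (hmono : StrictMono p) :
    ∃ S ∈ D.filtration 1,
      (∀ (i : Fin n) k, S (D.ι i.castSucc ((D.basis _).e k)) = D.ι i.succ ((D.basis _).e k)) ∧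
      ∀ k, S (D.ι (Fin.last n) ((D.basis _).e k)) = 0 := by
  choose J hJ using fun i : Fin n => (D.basis i.castSucc).exists_map_e (D.basis i.succ) (hp _)
    (hmono i.castSucc_lt_succ).le Function.injective_id
  have hS : ∀ x, (∑ i, D.ι i.succ ∘L J i ∘L D.π i.castSucc : X →L[𝕜] X) x =
      ∑ i, D.ι i.succ (J i (D.π i.castSucc x)) := fun x => by simp
  refine ⟨∑ i, D.ι i.succ ∘L J i ∘L D.π i.castSucc, fun i j hij => ?_, fun i k => ?_, fun k => ?_⟩
  · have : D.entry i j (∑ i, D.ι i.succ ∘L J i ∘L D.π i.castSucc) = 0 := by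
      ext x
      rw [entry_apply, hS, map_sum]
      refine Finset.sum_eq_zero fun l _ => ?_
      by_cases hl : l.castSucc = i
      · refine D.π_ι_ne _ _ (fun h => ?_) _
        rw [← hl, ← h] at hij
        simp at hij
      · rw [D.π_ι_ne _ _ (Ne.symm hl)]
        simp
    rw [this]
    exact isCompactOperator_zero
  · rw [hS, Finset.sum_eq_single i]
    · rw [D.π_ι, hJ, id]
    · intro l _ hl
      rw [D.π_ι_ne _ _ (by simpa using hl.symm)]
      simp
    · simp
  · rw [hS]
    refine Finset.sum_eq_zero fun l _ => ?_
    rw [D.π_ι_ne _ _ (Fin.castSucc_lt_last l).ne']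
    simp

theorem exists_diagonal_map [∀ i, CompleteSpace (E i)] (hp : ∀ i, 1 ≤ p i) {σ : ℕ → ℕ}
    (hσ : Function.Injective σ) :
    ∃ Q : X →L[𝕜] X, ∀ i k, Q (D.ι i ((D.basis i).e k)) = D.ι i ((D.basis i).e (σ k)) := by
  choose J hJ using fun i => (D.basis i).exists_map_e (D.basis i) (hp i) le_rfl hσ
  refine ⟨∑ i, D.ι i ∘L J i ∘L D.π i, fun i k => ?_⟩
  rw [sum_apply, Finset.sum_eq_single i]
  · simp [D.π_ι, hJ]
  · intro l _ hl
    simp [D.π_ι_ne _ _ hl.symm]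
  · simp

section Commutator

variable {Q R S : X →L[𝕜] X}

/-- The operators, strictly singular if `k ≠ 0`, whose commutator with `Q` lies in the `k`-th
term of the filtration. -/
def commutatorSubalgebra (Q : X →L[𝕜] X) (k : ℕ) : NonUnitalSubalgebra 𝕜 (X →L[𝕜] X) where
  carrier := {T | T ∈ D.filtration (min k 1) ∧ T * Q - Q * T ∈ D.filtration k}
  add_mem' {T U} hT hU := by
    refine ⟨add_mem hT.1 hU.1, ?_⟩
    have := add_mem hT.2 hU.2
    rwa [show T * Q - Q * T + (U * Q - Q * U) = (T + U) * Q - Q * (T + U) by noncomm_ring] at this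
  zero_mem' := ⟨zero_mem _, by simp⟩
  smul_mem' c T hT := by
    refine ⟨Submodule.smul_mem _ _ hT.1, ?_⟩
    have := Submodule.smul_mem _ c hT.2
    rwa [smul_sub, ← smul_mul_assoc, ← mul_smul_comm] at this
  mul_mem' {T U} hT hU := by
    refine ⟨D.filtration_anti (Nat.le_add_left _ _) (D.mul_mem_filtration hT.1 hU.1), ?_⟩
    have := add_mem (D.filtration_anti (Nat.le_add_left _ _) (D.mul_mem_filtration hT.1 hU.2))
      (D.filtration_anti (Nat.le_add_right _ _) (D.mul_mem_filtration hT.2 hU.1))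
    rwa [show T * (U * Q - Q * U) + (T * Q - Q * T) * U = T * U * Q - Q * (T * U) by
      noncomm_ring] at this

theorem mem_commutatorSubalgebra {k : ℕ} {T : X →L[𝕜] X} : T ∈ D.commutatorSubalgebra Q k ↔
    T ∈ D.filtration (min k 1) ∧ T * Q - Q * T ∈ D.filtration k := Iff.rfl

theorem isClosed_commutatorSubalgebra [∀ i, CompleteSpace (E i)] (k : ℕ) :
    IsClosed (D.commutatorSubalgebra Q k : Set (X →L[𝕜] X)) :=
  (D.isClosed_filtration _).inter ((D.isClosed_filtration k).preimage
    ((continuous_id.mul continuous_const).sub (continuous_const.mul continuous_id)))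

theorem isIdealOf_commutatorSubalgebra (k : ℕ) :
    IsIdealOf (D.commutatorSubalgebra Q (k + 1)) (D.commutatorSubalgebra Q k) := by
  refine ⟨fun T hT => ⟨D.filtration_anti (by omega) hT.1, D.filtration_anti (by omega) hT.2⟩,
    fun T hT U hU => ⟨⟨?_, ?_⟩, ⟨?_, ?_⟩⟩⟩
  · exact D.filtration_anti (by omega) (D.mul_mem_filtration hT.1 hU.1)
  · have := add_mem (D.filtration_anti (Nat.le_add_left _ _) (D.mul_mem_filtration hT.1 hU.2))
      (D.filtration_anti (show k + 1 ≤ k + min (k + 1) 1 by omega)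
        (D.mul_mem_filtration hT.2 hU.1))
    rwa [show T * (U * Q - Q * U) + (T * Q - Q * T) * U = T * U * Q - Q * (T * U) by
      noncomm_ring] at this
  · exact D.filtration_anti (by omega) (D.mul_mem_filtration hU.1 hT.1)
  · have := add_mem (D.filtration_anti (show k + 1 ≤ min (k + 1) 1 + k by omega)
      (D.mul_mem_filtration hU.1 hT.2))
      (D.filtration_anti (Nat.le_add_right _ _) (D.mul_mem_filtration hU.2 hT.1))
    rwa [show U * (T * Q - Q * T) + (U * Q - Q * U) * T = U * T * Q - Q * (U * T) by
      noncomm_ring] at this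

theorem isClosedNSubideal_commutatorSubalgebra [∀ i, CompleteSpace (E i)] (hp : ∀ i, 1 ≤ p i)
    (hmono : StrictMono p) (k : ℕ) :
    IsClosedNSubideal 𝕜 k (D.commutatorSubalgebra Q k : Set (X →L[𝕜] X)) := by
  refine ⟨D.commutatorSubalgebra Q, Set.eq_univ_of_forall fun T => ?_, rfl,
    fun k _ => D.isClosed_commutatorSubalgebra k, fun k _ => D.isIdealOf_commutatorSubalgebra k⟩
  have h : D.filtration 0 = ⊤ := D.filtration_zero hp hmono
  simp [mem_commutatorSubalgebra, h]

theorem shift_pow_apply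
    (hS : ∀ (i : Fin n) k, S (D.ι i.castSucc ((D.basis _).e k)) = D.ι i.succ ((D.basis _).e k))
    (j : ℕ) (hj : j < n + 1) (k : ℕ) :
    (S ^ j) (D.ι 0 ((D.basis 0).e k)) = D.ι ⟨j, hj⟩ ((D.basis ⟨j, hj⟩).e k) := by
  induction j with
  | zero => rfl
  | succ j ih =>
    rw [pow_succ', mul_apply_eq_comp, ih (by omega)]
    exact hS ⟨j, by omega⟩ k

theorem not_isCompactOperator_commutator (hp : ∀ i, 1 ≤ p i)
    (hS : ∀ (i : Fin n) k, S (D.ι i.castSucc ((D.basis _).e k)) = D.ι i.succ ((D.basis _).e k))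
    (hQ : ∀ i k, Q (D.ι i ((D.basis i).e k)) = D.ι i ((D.basis i).e (2 * k)))
    (hR : ∀ i k, R (D.ι i ((D.basis i).e k)) = D.ι i ((D.basis i).e (2 * k + 1))) :
    ¬IsCompactOperator (S ^ n * R * Q - Q * (S ^ n * R)) := by
  have h1 : ∀ k, (S ^ n * R * Q - Q * (S ^ n * R)) (D.ι 0 ((D.basis 0).e k)) =
      D.ι (Fin.last n) ((D.basis _).e (2 * (2 * k) + 1)) -
        D.ι (Fin.last n) ((D.basis _).e (2 * (2 * k + 1))) := by
    intro k
    simp only [sub_apply, mul_apply_eq_comp, hQ, hR, D.shift_pow_apply hS n n.lt_succ_self]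
    rfl
  refine not_isCompactOperator_of_separated _ (x := fun k => D.ι 0 ((D.basis 0).e k))
    (r := ‖D.ι 0‖) (δ := (‖D.π (Fin.last n)‖ + 1)⁻¹) (fun k => ?_) (by positivity)
    fun a b hab => ?_
  · simpa [(D.basis 0).norm_e (hp 0)] using (D.ι 0).le_opNorm ((D.basis 0).e k)
  · rw [h1, h1]
    set v := D.ι (Fin.last n) ((D.basis _).e (2 * (2 * a) + 1)) -
        D.ι (Fin.last n) ((D.basis _).e (2 * (2 * a + 1))) -
      (D.ι (Fin.last n) ((D.basis _).e (2 * (2 * b) + 1)) -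
        D.ι (Fin.last n) ((D.basis _).e (2 * (2 * b + 1)))) with hv
    have h2 : (D.basis (Fin.last n)).coord (2 * (2 * a) + 1) (D.π (Fin.last n) v) = 1 := by
      simp only [hv, map_sub, D.π_ι, LpBasis.coord_e]
      rw [if_pos trivial, if_neg (by omega), if_neg (by omega), if_neg (by omega)]
      simp
    have h3 := (D.basis (Fin.last n)).norm_coord_le (hp _) (2 * (2 * a) + 1)
      (D.π (Fin.last n) v)
    rw [h2, norm_one] at h3
    have h4 := (D.π (Fin.last n)).le_opNorm v
    rw [inv_le_iff_one_le_mul₀ (by positivity)]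
    linarith [norm_nonneg v, mul_comm ‖v‖ (‖D.π (Fin.last n)‖ + 1)]

theorem not_isClosedNSubideal_commutatorSubalgebra
    (hR : ¬IsCompactOperator (S ^ n * R * Q - Q * (S ^ n * R)))
    (hS : S ∈ D.commutatorSubalgebra Q (n + 1)) :
    ¬IsClosedNSubideal 𝕜 n (D.commutatorSubalgebra Q (n + 1) : Set (X →L[𝕜] X)) := by
  rintro ⟨C, hC0, hCn, -, hid⟩
  have hle : ∀ k ≤ n, S ∈ C k := by
    intro k hk
    induction hk using Nat.decreasingInduction with
    | self => exact Set.ext_iff.1 hCn S |>.2 hS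
    | of_succ k hk ih => exact (hid k hk).1 ih
  have hpow : ∀ k ≤ n, S ^ k * R ∈ C k := by
    intro k
    induction k with
    | zero => exact fun _ => SetLike.mem_coe.1 (hC0 ▸ Set.mem_univ _)
    | succ k ih =>
      intro hk
      rw [pow_succ', mul_assoc]
      exact ((hid k hk).2 _ (ih (by omega)) _ (hle _ hk)).2
  have h : S ^ n * R ∈ D.commutatorSubalgebra Q (n + 1) :=
    SetLike.mem_coe.1 (hCn ▸ hpow n le_rfl)
  exact hR (D.mem_filtration_iff_isCompactOperator.1 h.2)

theorem exists_shift_and_commutator [∀ i, CompleteSpace (E i)] (D : LpDirectSum 𝕜 p E X)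
    (hp : ∀ i, 1 ≤ p i) (hmono : StrictMono p) :
    ∃ S Q R : X →L[𝕜] X, S ∈ D.filtration 1 ∧ S * Q - Q * S = 0 ∧
      ¬IsCompactOperator (S ^ n * R * Q - Q * (S ^ n * R)) := by
  obtain ⟨S, hS, hS1, hS2⟩ := D.exists_shift hp hmono
  obtain ⟨Q, hQ⟩ := D.exists_diagonal_map hp (σ := fun k => 2 * k) fun a b h => by
    simpa using h
  obtain ⟨R, hR⟩ := D.exists_diagonal_map hp (σ := fun k => 2 * k + 1) fun a b h => by
    simpa using h
  refine ⟨S, Q, R, hS, sub_eq_zero.2 (D.ext_e fun i k => ?_),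
    D.not_isCompactOperator_commutator hp hS1 hQ hR⟩
  cases i using Fin.lastCases with
  | last => simp [hQ, hS2]
  | cast i => simp [hQ, hS1]

theorem exists_pow_not_isCompactOperator [∀ i, CompleteSpace (E i)] (D : LpDirectSum 𝕜 p E X)
    (hp : ∀ i, 1 ≤ p i) (hmono : StrictMono p) :
    ∃ S : X →L[𝕜] X, IsStrictlySingular S ∧ ¬IsCompactOperator (S ^ n) := by
  obtain ⟨S, Q, R, hS, -, h⟩ := D.exists_shift_and_commutator hp hmono
  refine ⟨S, D.isStrictlySingular_of_mem_filtration_one hp hmono hS, fun hc => h ?_⟩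
  have h1 : IsCompactOperator (S ^ n * R) := hc.comp_clm R
  have h2 : IsCompactOperator (S ^ n * R * Q) := h1.comp_clm Q
  have h3 : IsCompactOperator (Q * (S ^ n * R)) := h1.clm_comp Q
  exact h2.sub h3

theorem exists_isClosedNSubideal [∀ i, CompleteSpace (E i)] (D : LpDirectSum 𝕜 p E X)
    (hp : ∀ i, 1 ≤ p i) (hmono : StrictMono p) :
    ∃ M : Set (X →L[𝕜] X), (∀ U ∈ M, IsStrictlySingular U) ∧
      IsClosedNSubideal 𝕜 (n + 1) M ∧ ¬IsClosedNSubideal 𝕜 n M := by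
  obtain ⟨S, Q, R, hS, hSQ, h⟩ := D.exists_shift_and_commutator hp hmono
  refine ⟨D.commutatorSubalgebra Q (n + 1), fun U hU => ?_,
    D.isClosedNSubideal_commutatorSubalgebra hp hmono _,
    D.not_isClosedNSubideal_commutatorSubalgebra h ⟨?_, hSQ ▸ zero_mem _⟩⟩
  · exact D.isStrictlySingular_of_mem_filtration_one hp hmono
      (D.filtration_anti (by omega) hU.1)
  · exact D.filtration_anti (by omega) hS

end Commutator

end LpDirectSum

end Subideals

section Models

variable (𝕜 : Type) [RCLike 𝕜]

/-- The unit vector basis of `ℓ^p`. -/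
def lpBasis (p : ℝ≥0∞) [Fact (1 ≤ p)] (hp : p ≠ ∞) : LpBasis 𝕜 p (lp (fun _ : ℕ => 𝕜) p) where
  coord k := LinearMap.mkContinuous
    { toFun := fun x => x k
      map_add' := fun _ _ => rfl
      map_smul' := fun _ _ => rfl } 1 fun x => by
        rw [one_mul]
        exact lp.norm_apply_le_norm (zero_lt_one.trans_le (Fact.out : 1 ≤ p)).ne' x k
  e k := lp.single p k 1
  coord_e k l := Pi.single_apply l 1 k
  tendsto x := by
    refine (lp.hasSum_single hp x).tendsto_sum_nat.congr fun N => Finset.sum_congr rfl fun k _ => ?_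
    rw [← lp.single_smul, smul_eq_mul, mul_one]
    rfl
  norm_sum s a := by
    have h0 := toReal_pos_of_one_le (Fact.out : 1 ≤ p) hp
    have h := lp.norm_sum_single (E := fun _ : ℕ => 𝕜) h0 a s
    have h1 : ∀ k, a k • lp.single (E := fun _ : ℕ => 𝕜) p k 1 = lp.single p k (a k) := fun k => by
      simp [← lp.single_smul]
    rw [lpSum, if_neg hp, NNReal.eq_rpow_inv_iff h0.ne', ← NNReal.coe_inj]
    push_cast
    simpa only [h1] using h

/-- The unit vectors of `c₀`. -/
def c₀Single (k : ℕ) : ZeroAtInftyContinuousMap ℕ 𝕜 where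
  toFun := Pi.single k 1
  continuous_toFun := continuous_of_discreteTopology
  zero_at_infty' := by
    rw [cocompact_eq_cofinite, Nat.cofinite_eq_atTop]
    refine tendsto_const_nhds.congr' ?_
    filter_upwards [eventually_gt_atTop k] with l hl
    exact (Pi.single_eq_of_ne (M := fun _ => 𝕜) hl.ne' 1).symm

theorem c₀Single_apply (k l : ℕ) : c₀Single 𝕜 k l = if l = k then 1 else 0 :=
  Pi.single_apply k 1 l

variable {𝕜}

theorem sum_c₀Single_apply (s : Finset ℕ) (a : ℕ → 𝕜) (l : ℕ) :
    (∑ k ∈ s, a k • c₀Single 𝕜 k) l = if l ∈ s then a l else 0 := by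
  classical
  induction s using Finset.induction_on with
  | empty => simp
  | insert k s hk ih =>
    rw [Finset.sum_insert hk, ZeroAtInftyContinuousMap.add_apply, ih,
      ZeroAtInftyContinuousMap.smul_apply, c₀Single_apply]
    rcases eq_or_ne l k with rfl | h
    · simp [hk]
    · simp [h]

theorem c₀_norm_le {x : ZeroAtInftyContinuousMap ℕ 𝕜} {r : ℝ} (hr : 0 ≤ r) :
    ‖x‖ ≤ r ↔ ∀ k, ‖x k‖ ≤ r :=
  BoundedContinuousFunction.norm_le (f := x.toBCF) hr

variable (𝕜)

/-- The unit vector basis of `c₀`. -/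
def c₀Basis : LpBasis 𝕜 ∞ (ZeroAtInftyContinuousMap ℕ 𝕜) where
  coord k := LinearMap.mkContinuous
    { toFun := fun x => x k
      map_add' := fun _ _ => rfl
      map_smul' := fun _ _ => rfl } 1 fun x => by
        simpa using (c₀_norm_le (norm_nonneg x)).1 le_rfl k
  e := c₀Single 𝕜
  coord_e k l := c₀Single_apply 𝕜 l k
  tendsto x := by
    have hx := x.zero_at_infty'
    rw [cocompact_eq_cofinite, Nat.cofinite_eq_atTop] at hx
    rw [Metric.tendsto_atTop]
    intro ε hε
    obtain ⟨N, hN⟩ := Metric.tendsto_atTop.1 hx (ε / 2) (half_pos hε)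
    refine ⟨N, fun n hn => ?_⟩
    rw [dist_eq_norm]
    refine ((c₀_norm_le (half_pos hε).le).2 fun k => ?_).trans_lt (half_lt_self hε)
    rw [ZeroAtInftyContinuousMap.sub_apply, sum_c₀Single_apply]
    split_ifs with h
    · simpa using (half_pos hε).le
    · have := hN k (by simp at h; omega)
      rw [dist_zero_right] at this
      simpa using this.le
  norm_sum s a := by
    rw [lpSum, if_pos rfl]
    refine le_antisymm ?_ (Finset.sup_le fun k hk => ?_)
    · rw [← NNReal.coe_le_coe]
      refine (c₀_norm_le (NNReal.coe_nonneg _)).2 fun k => ?_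
      rw [sum_c₀Single_apply]
      split_ifs with h
      · exact_mod_cast Finset.le_sup (f := fun k => ‖a k‖₊) h
      · simp
    · have := (c₀_norm_le (x := ∑ k ∈ s, a k • c₀Single 𝕜 k) (norm_nonneg _)).1 le_rfl k
      rw [sum_c₀Single_apply, if_pos hk] at this
      exact_mod_cast this

theorem seqSp_model (p : ℝ≥0∞) [Fact (1 ≤ p)] :
    Nonempty (LpBasis 𝕜 p (seqSp 𝕜 p)) ∧ CompleteSpace (seqSp 𝕜 p) := by
  suffices h : ∀ B : BundledSp 𝕜, B = seqSpB 𝕜 p →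
      Nonempty (LpBasis 𝕜 p B.carrier) ∧ CompleteSpace B.carrier from h _ rfl
  intro B hB
  by_cases hp : p = ∞
  · obtain rfl := hB.trans (if_pos hp)
    exact ⟨⟨hp ▸ c₀Basis 𝕜⟩, inferInstanceAs (CompleteSpace (ZeroAtInftyContinuousMap ℕ 𝕜))⟩
  · obtain rfl := hB.trans (if_neg hp)
    exact ⟨⟨lpBasis 𝕜 p hp⟩, inferInstanceAs (CompleteSpace (lp (fun _ : ℕ => 𝕜) p))⟩

instance (p : ℝ≥0∞) [Fact (1 ≤ p)] : CompleteSpace (seqSp 𝕜 p) := (seqSp_model 𝕜 p).2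

/-- The finite direct sum with the maximum norm. -/
def piLpDirectSum {n : ℕ} (p : Fin (n + 1) → ℝ≥0∞) [∀ i, Fact (1 ≤ p i)] :
    LpDirectSum 𝕜 p (fun i => seqSp 𝕜 (p i)) (PiLp ⊤ (fun i => seqSp 𝕜 (p i))) where
  basis i := (seqSp_model 𝕜 (p i)).1.some
  ι i := (PiLp.continuousLinearEquiv ⊤ 𝕜 (fun i => seqSp 𝕜 (p i))).symm.toContinuousLinearMap ∘L
    ContinuousLinearMap.single 𝕜 (fun i => seqSp 𝕜 (p i)) i
  π i := PiLp.proj ⊤ (fun i => seqSp 𝕜 (p i)) i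
  π_ι i x := by
    simp
  π_ι_ne i j h x := by
    simp [h.symm]
  sum_ι_π x := by
    ext j
    simp [Finset.sum_apply]

end Models

/-- Let `n ∈ ℕ`, `1 ≤ p_1 < p_2 < ⋯ < p_{n+1} ≤ ∞` and
`X_n = ℓ^{p_1} ⊕ ⋯ ⊕ ℓ^{p_{n+1}}` with the max norm (`ℓ^∞ = c_0`).  Then:
(i) every product of `n + 1` strictly singular operators on `X_n` is compact (so
`S(X_n)/K(X_n)` is `(n+1)`-nilpotent), and the operator-norm closure of `S(X_n)^{n+1}`
equals `K(X_n)`;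
(ii) there is `S ∈ S(X_n)` with `S^n ∉ K(X_n)`;
(iii) there is a closed subalgebra `M ⊆ S(X_n)` which is a closed `(n+1)`-subideal of
`L(X_n)` but not a closed `n`-subideal of `L(X_n)`. -/
theorem strictly_singular_subideals_on_finite_sum_of_lp
    (𝕜 : Type) [RCLike 𝕜] (n : ℕ) (hn : 1 ≤ n)
    (p : Fin (n + 1) → ℝ≥0∞) [∀ i, Fact (1 ≤ p i)] (hpmono : StrictMono p) :
    (∀ T ∈ prodsOf {U : PiLp ⊤ (fun i => seqSp 𝕜 (p i)) →L[𝕜] PiLp ⊤ (fun i => seqSp 𝕜 (p i)) |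
        IsStrictlySingular U} n,
      IsCompactOperator (⇑T)) ∧
    closure ((Submodule.span 𝕜
        (prodsOf {U : PiLp ⊤ (fun i => seqSp 𝕜 (p i)) →L[𝕜] PiLp ⊤ (fun i => seqSp 𝕜 (p i)) |
          IsStrictlySingular U} n) :
        Submodule 𝕜 (PiLp ⊤ (fun i => seqSp 𝕜 (p i)) →L[𝕜] PiLp ⊤ (fun i => seqSp 𝕜 (p i)))) :
        Set (PiLp ⊤ (fun i => seqSp 𝕜 (p i)) →L[𝕜] PiLp ⊤ (fun i => seqSp 𝕜 (p i)))) =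
      {T : PiLp ⊤ (fun i => seqSp 𝕜 (p i)) →L[𝕜] PiLp ⊤ (fun i => seqSp 𝕜 (p i)) |
        IsCompactOperator (⇑T)} ∧
    (∃ S : PiLp ⊤ (fun i => seqSp 𝕜 (p i)) →L[𝕜] PiLp ⊤ (fun i => seqSp 𝕜 (p i)),
      IsStrictlySingular S ∧ ¬IsCompactOperator (⇑(S ^ n))) ∧
    (∃ M : Set (PiLp ⊤ (fun i => seqSp 𝕜 (p i)) →L[𝕜] PiLp ⊤ (fun i => seqSp 𝕜 (p i))),
      (∀ U ∈ M, IsStrictlySingular U) ∧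
      IsClosedNSubideal 𝕜 (n + 1) M ∧ ¬IsClosedNSubideal 𝕜 n M) := by
  have hp : ∀ i, 1 ≤ p i := fun i => Fact.out
  have D := piLpDirectSum 𝕜 p
  exact ⟨fun T hT => D.mem_filtration_iff_isCompactOperator.1
      (D.prodsOf_subset_filtration hp hpmono n hT),
    D.closure_span_prodsOf hp hpmono, D.exists_pow_not_isCompactOperator hp hpmono,
    D.exists_isClosedNSubideal hp hpmono⟩

end
end
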